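/- arXiv:2003.02726 — 2 statements merged into one kernel-verified Lean document; each statement's English description precedes it below -/
import Mathlib

section
/- Let A be a unital associative ℚ-algebra containing elements x_{μν}, ∂_{μν} (1 ≤ μ,ν ≤ n) with x_{μν} = -x_{νμ}, ∂_{μν} = -∂_{νμ}, satisfying [x_{μν},x_{αβ}] = 0, [∂_{μν},∂_{αβ}] = 0, [∂_{μν},x_{αβ}] = δ_{μα}δ_{νβ} - δ_{μβ}δ_{να}. Let ∂ be the n×n matrix [∂_{μν}] with ordinary matrix powers, and let K_{(μν)(αβ)} = (1/2)(δ_{μα}∂_{νβ} - δ_{μβ}∂_{να} + δ_{νβ}∂_{μα} - δ_{να}∂_{μβ}) with powers (K⁰)_{(μν)(αβ)} = (1/2)(δ_{μα}δ_{νβ} - δ_{μβ}δ_{να}), (K^m)_{(μν)(αβ)} = Σ_{θ,σ} K_{(μν)(θσ)}(K^{m-1})_{(θσ)(αβ)}, and (-K)^m defined analogously from -K. Then for every m ≥ 1: [x_{αβ}, (∂^m)_{ρσ}] = 2 Σ_{k=1}^m binom(m,k) Σ_{μ=1}^n ((-K)^{k-1})_{(αβ)(μρ)} (∂^{m-k})_{μσ}.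 -/
/-- Kronecker delta with rational values. -/
def kd {n : ℕ} (a b : Fin n) : ℚ := if a = b then 1 else 0

/-- `K_{(μν)(αβ)} = (1/2)(δ_{μα}∂_{νβ} - δ_{μβ}∂_{να} + δ_{νβ}∂_{μα} - δ_{να}∂_{μβ})` in `A`. -/
noncomputable def Kop {A : Type*} [Ring A] [Algebra ℚ A] {n : ℕ}
    (d : Fin n → Fin n → A) (μ ν α β : Fin n) : A :=
  (1/2 : ℚ) • ((kd μ α : ℚ) • d ν β - (kd μ β : ℚ) • d ν α
    + (kd ν β : ℚ) • d μ α - (kd ν α : ℚ) • d μ β)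

/-- Powers of `K` (contraction over all ordered pairs). -/
noncomputable def Kpow {A : Type*} [Ring A] [Algebra ℚ A] {n : ℕ}
    (d : Fin n → Fin n → A) : ℕ → Fin n → Fin n → Fin n → Fin n → A
  | 0 => fun μ ν α β => ((1/2 : ℚ) * (kd μ α * kd ν β - kd μ β * kd ν α)) • (1 : A)
  | m+1 => fun μ ν α β => ∑ θ, ∑ σ, Kop d μ ν θ σ * Kpow d m θ σ α β

/-- Powers of `-K`, defined analogously from `-K`. -/
noncomputable def negKpow {A : Type*} [Ring A] [Algebra ℚ A] {n : ℕ}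
    (d : Fin n → Fin n → A) : ℕ → Fin n → Fin n → Fin n → Fin n → A
  | 0 => fun μ ν α β => ((1/2 : ℚ) * (kd μ α * kd ν β - kd μ β * kd ν α)) • (1 : A)
  | m+1 => fun μ ν α β => ∑ θ, ∑ σ, (-(Kop d μ ν θ σ)) * negKpow d m θ σ α β

/-- Ordinary matrix powers of `∂ = [∂_{μν}]`. -/
noncomputable def dpow {A : Type*} [Ring A] [Algebra ℚ A] {n : ℕ}
    (d : Fin n → Fin n → A) : ℕ → Fin n → Fin n → A
  | 0 => fun μ ν => (kd μ ν : ℚ) • (1 : A)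
  | m+1 => fun μ ν => ∑ α, dpow d m μ α * d α ν

section Powers

variable {A : Type*} [Ring A] [Algebra ℚ A] {n : ℕ} (d : Fin n → Fin n → A)

theorem kd_comm (a b : Fin n) : kd a b = kd b a := by
  simp only [kd, eq_comm]

theorem sum_kd_smul (a : Fin n) (f : Fin n → A) : ∑ b, kd a b • f b = f a := by
  simp [kd, ite_smul]

theorem dpow_eq_pow (m : ℕ) (μ ν : Fin n) : dpow d m μ ν = (Matrix.of d ^ m) μ ν := by
  induction m generalizing ν with
  | zero => simp [dpow, kd, Matrix.one_apply, ite_smul]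
  | succ m ih => simp [dpow, pow_succ, Matrix.mul_apply, ih]

theorem negKpow_swap (m : ℕ) (α β μ ν : Fin n) :
    negKpow d m α β μ ν = -negKpow d m α β ν μ := by
  induction m generalizing α β with
  | zero =>
    simp only [negKpow, ← neg_smul]
    congr 1
    ring
  | succ m ih =>
    simp only [negKpow, ← Finset.sum_neg_distrib]
    refine Finset.sum_congr rfl fun θ _ => Finset.sum_congr rfl fun σ _ => ?_
    rw [ih θ σ, mul_neg]

theorem commute_Kop {a : A} (ha : ∀ μ ν, Commute (d μ ν) a) (μ ν α β : Fin n) :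
    Commute (Kop d μ ν α β) a :=
  ((((((ha _ _).smul_left _).sub_left ((ha _ _).smul_left _)).add_left
    ((ha _ _).smul_left _)).sub_left ((ha _ _).smul_left _)).smul_left _)

theorem commute_negKpow {a : A} (ha : ∀ μ ν, Commute (d μ ν) a) (m : ℕ) (α β μ ν : Fin n) :
    Commute (negKpow d m α β μ ν) a := by
  induction m generalizing α β with
  | zero => exact (Commute.one_left a).smul_left _
  | succ m ih =>
    exact Commute.sum_left _ _ _ fun θ _ => Commute.sum_left _ _ _ fun σ _ =>
      (commute_Kop d ha _ _ _ _).neg_left.mul_left (ih θ σ)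

/-- Contracting on the right with `-K` an array antisymmetric in its last pair of indices. -/
theorem sum_mul_neg_Kop {X : Fin n → Fin n → A} (hX : ∀ μ ν, X μ ν = -X ν μ) (μ ν : Fin n) :
    ∑ θ, ∑ σ, X θ σ * -Kop d θ σ μ ν = ∑ τ, X ν τ * d τ μ - ∑ τ, X μ τ * d τ ν := by
  have h₁ (a b : Fin n) : ∑ θ, ∑ σ, X θ σ * (kd θ a • d σ b) = ∑ τ, X a τ * d τ b := by
    rw [Finset.sum_comm]
    simp only [mul_smul_comm, kd_comm _ a, sum_kd_smul]
  have h₂ (a b : Fin n) : ∑ θ, ∑ σ, X θ σ * (kd σ a • d θ b) = -∑ τ, X a τ * d τ b := by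
    simp only [mul_smul_comm, kd_comm _ a, sum_kd_smul, hX _ a, neg_mul,
      Finset.sum_neg_distrib]
  simp only [Kop, mul_neg, mul_smul_comm (1 / 2 : ℚ), mul_add, mul_sub, Finset.sum_neg_distrib,
    ← Finset.smul_sum, Finset.sum_add_distrib, Finset.sum_sub_distrib, h₁, h₂]
  module

theorem negKpow_one (α β μ ν : Fin n) :
    negKpow d 1 α β μ ν = ∑ θ, ∑ σ, negKpow d 0 α β θ σ * -Kop d θ σ μ ν := by
  have hL (a b : Fin n) (f : Fin n → Fin n → A) : ∑ θ, ∑ σ, f θ σ *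
      (((1 / 2 : ℚ) * (kd θ a * kd σ b - kd θ b * kd σ a)) • (1 : A))
        = (1 / 2 : ℚ) • (f a b - f b a) := by
    simp [kd, mul_sub, sub_smul, smul_sub, Finset.sum_sub_distrib, ite_smul, mul_ite]
  have hR (a b : Fin n) (f : Fin n → Fin n → A) : ∑ θ, ∑ σ,
      (((1 / 2 : ℚ) * (kd a θ * kd b σ - kd a σ * kd b θ)) • (1 : A)) * f θ σ
        = (1 / 2 : ℚ) • (f a b - f b a) := by
    simp [kd, mul_sub, sub_smul, sub_mul, smul_sub, Finset.sum_sub_distrib, ite_smul, ite_mul]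
  simp only [negKpow]
  rw [hL, hR]
  simp only [Kop]
  module

theorem negKpow_succ_right (m : ℕ) (α β μ ν : Fin n) :
    negKpow d (m + 1) α β μ ν = ∑ θ, ∑ σ, negKpow d m α β θ σ * -Kop d θ σ μ ν := by
  induction m generalizing α β with
  | zero => exact negKpow_one d α β μ ν
  | succ m ih =>
    rw [negKpow]
    simp only [ih]
    simp only [negKpow, ← Fintype.sum_prod_type']
    simp only [Finset.mul_sum, Finset.sum_mul, mul_assoc]
    rw [Finset.sum_comm]

theorem negKpow_succ_matrix (hd : ∀ μ ν, d μ ν = -d ν μ)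
    (hdd : ∀ μ ν α β, Commute (d μ ν) (d α β)) (m : ℕ) (α β : Fin n) :
    Matrix.of (negKpow d (m + 1) α β) =
      Matrix.of d * Matrix.of (negKpow d m α β) - Matrix.of (negKpow d m α β) * Matrix.of d := by
  ext μ ν
  simp only [Matrix.of_apply, Matrix.sub_apply, Matrix.mul_apply]
  rw [negKpow_succ_right d, sum_mul_neg_Kop d (negKpow_swap d m α β)]
  congr 1
  refine Finset.sum_congr rfl fun τ _ => ?_
  rw [negKpow_swap, hd τ μ, neg_mul_neg]
  exact commute_negKpow d (fun _ _ => hdd _ _ _ _) _ _ _ _ _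

end Powers

section Ring

variable {R : Type*} [Ring R] {D : R} {Y : ℕ → R}

theorem pow_mul_eq_sum_choose (hY : ∀ k, Y (k + 1) = D * Y k - Y k * D) (m : ℕ) :
    D ^ m * Y 0 = ∑ k ∈ Finset.range (m + 1), m.choose k • (Y k * D ^ (m - k)) := by
  set L := LinearMap.mulLeft ℤ D
  set T := LinearMap.mulRight ℤ D
  have hc : Commute L T := LinearMap.commute_mulLeft_right D D
  have hk (k : ℕ) : ((L - T) ^ k) (Y 0) = Y k := by
    induction k with
    | zero => rfl
    | succ k ih => rw [pow_succ', Module.End.mul_apply, ih, hY]; rfl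
  have h := congrArg (fun f => f (Y 0)) ((hc.sub_left (Commute.refl T)).add_pow m)
  simp only [sub_add_cancel] at h
  rw [LinearMap.pow_mulLeft, LinearMap.mulLeft_apply, LinearMap.sum_apply] at h
  rw [h]
  refine Finset.sum_congr rfl fun k _ => ?_
  rw [← Nat.cast_comm, ← nsmul_eq_mul, LinearMap.smul_apply,
    ((hc.sub_left (Commute.refl T)).pow_pow k (m - k)).eq, Module.End.mul_apply, hk,
    LinearMap.pow_mulRight, LinearMap.mulRight_apply]

/-- The sequence `C` behaves like `m ↦ ⁅x, D ^ m⁆` with `⁅x, D⁆ = Y 0`. -/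
theorem eq_sum_choose_of_leibniz (hY : ∀ k, Y (k + 1) = D * Y k - Y k * D) {C : ℕ → R}
    (hC₀ : C 0 = 0) (hC : ∀ m, C (m + 1) = C m * D + D ^ m * Y 0) (m : ℕ) :
    C m = ∑ k ∈ Finset.Icc 1 m, m.choose k • (Y (k - 1) * D ^ (m - k)) := by
  have hIcc (m : ℕ) (f : ℕ → R) :
      ∑ k ∈ Finset.Icc 1 m, f k = ∑ k ∈ Finset.range m, f (k + 1) := by
    rw [Finset.range_eq_Ico, Finset.sum_Ico_add' f 0 m 1, zero_add]
    rfl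
  rw [hIcc]
  simp only [Nat.add_sub_cancel]
  induction m with
  | zero => simpa using hC₀
  | succ m ih =>
    have hS : ∑ k ∈ Finset.range m, m.choose (k + 1) • (Y k * D ^ (m - (k + 1))) * D
        = ∑ k ∈ Finset.range (m + 1), m.choose (k + 1) • (Y k * D ^ (m - k)) := by
      rw [Finset.sum_range_succ, Nat.choose_succ_self, zero_smul, add_zero]
      refine Finset.sum_congr rfl fun k hk => ?_
      rw [smul_mul_assoc, mul_assoc, ← pow_succ]
      congr 3
      have := Finset.mem_range.1 hk
      omega
    rw [hC, ih, Finset.sum_mul, hS, pow_mul_eq_sum_choose hY, ← Finset.sum_add_distrib]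
    refine Finset.sum_congr rfl fun k _ => ?_
    rw [← add_smul, Nat.choose_succ_succ, add_comm, Nat.add_sub_add_right]

end Ring

/-- Proposition A3: in the generalized Heisenberg algebra `H_n`,
`[x_{αβ},(∂^m)_{ρσ}] = 2 Σ_{k=1}^m binom(m,k) Σ_μ ((-K)^{k-1})_{(αβ)(μρ)}(∂^{m-k})_{μσ}`. -/
theorem statement9 {A : Type*} [Ring A] [Algebra ℚ A]
    (n : ℕ) (hn : 2 ≤ n)
    (x d : Fin n → Fin n → A)
    (hxanti : ∀ μ ν, x μ ν = - x ν μ)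
    (hdanti : ∀ μ ν, d μ ν = - d ν μ)
    (hxx : ∀ μ ν α β, x μ ν * x α β - x α β * x μ ν = 0)
    (hdd : ∀ μ ν α β, d μ ν * d α β - d α β * d μ ν = 0)
    (hdx : ∀ μ ν α β, d μ ν * x α β - x α β * d μ ν
      = (kd μ α * kd ν β - kd μ β * kd ν α : ℚ) • (1 : A)) :
    ∀ (m : ℕ), 1 ≤ m → ∀ α β ρ σ : Fin n,
      x α β * dpow d m ρ σ - dpow d m ρ σ * x α β
        = (2 : ℚ) • ∑ k ∈ Finset.Icc 1 m, (m.choose k : ℚ) •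
            ∑ μ, negKpow d (k-1) α β μ ρ * dpow d (m-k) μ σ := by
  have hdd' (μ ν α β) : Commute (d μ ν) (d α β) := sub_eq_zero.1 (hdd μ ν α β)
  intro m _ α β ρ σ
  set D := Matrix.of d with hD
  set X := Matrix.scalar (Fin n) (x α β) with hX
  set Y : ℕ → Matrix (Fin n) (Fin n) A := fun k => -(2 : ℚ) • Matrix.of (negKpow d k α β) with hYdef
  have hY (k : ℕ) : Y (k + 1) = D * Y k - Y k * D := by
    simp only [hYdef, negKpow_succ_matrix d hdanti hdd', smul_sub, mul_smul_comm, smul_mul_assoc,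
      hD]
  have hXD : X * D - D * X = Y 0 := by
    ext μ ν
    have h := hdx μ ν α β
    rw [← neg_sub, neg_eq_iff_eq_neg] at h
    simp only [hX, hYdef, hD, Matrix.sub_apply, Matrix.scalar_apply, Matrix.diagonal_mul,
      Matrix.mul_diagonal, Matrix.of_apply, Matrix.smul_apply, negKpow, h, smul_smul, ← neg_smul]
    rw [kd_comm μ α, kd_comm ν β, kd_comm μ β, kd_comm ν α]
    congr 1
    ring
  have hC := eq_sum_choose_of_leibniz hY (C := fun m => X * D ^ m - D ^ m * X) (by simp)
    (fun m => by rw [← hXD, pow_succ]; noncomm_ring) m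
  have h := congrFun (congrFun hC ρ) σ
  simp only [hX, Matrix.sub_apply, Matrix.scalar_apply, Matrix.diagonal_mul,
      Matrix.mul_diagonal, Matrix.sum_apply] at h
  rw [dpow_eq_pow, h, Finset.smul_sum]
  refine Finset.sum_congr rfl fun k _ => ?_
  simp only [hYdef, Matrix.smul_apply, smul_mul_assoc, Matrix.mul_apply, Matrix.of_apply,
    dpow_eq_pow, ← hD, negKpow_swap d (k - 1) α β _ ρ, neg_mul, Finset.sum_neg_distrib]
  rw [← Nat.cast_smul_eq_nsmul ℚ]
  module
end

section
/- Let η = diag(-1,1,…,1). Let P = ℝ[x_{μν} (1 ≤ μ < ν ≤ n), p_μ (1 ≤ μ ≤ n)] with x_{νμ} := -x_{μν}, multiplication operators x_{αβ}, p_α, derivations ∂_{μν} with [∂_{μν},x_{αβ}] = η_{μα}η_{νβ} - η_{μβ}η_{να}, [∂_{μν},p_α] = 0, and derivations ∂_μ with [∂_μ,p_ν] = η_{μν}, [∂_μ,x_{αβ}] = 0. Let K̃ be the (n+n²)×(n+n²) upper-triangular block operator matrix with blocks A_{μν} = ∂_{μν}, C_{(μν)α} = η_{αμ}∂_ν - η_{αν}∂_μ,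 D_{(μν)(αβ)} = (1/2)(η_{μα}∂_{νβ} - η_{μβ}∂_{να} + η_{νβ}∂_{μα} - η_{να}∂_{μβ}), with η-contracted powers defined by K̃⁰ having blocks (A⁰)_{μν} = η_{μν}, (D⁰)_{(μν)(αβ)} = (1/2)(η_{μα}η_{νβ} - η_{μβ}η_{να}) and mixed block 0, and K̃^m obtained by η-contraction of K̃ with K̃^{m-1} in all indices. Define the locally finite sums ψ(K̃) = Σ_{k≥0}((-1)^k B_k/k!)K̃^k and the operators P̂_μ = Σ_{α,α'} p_α η_{αα'} ∘ ψ(K̃)_{μα'} and M̂_{μν} = Σ_{α,β,α',β'} x_{αβ} η_{αα'} η_{ββ'} ∘ ψ(K̃)_{(μν)(α'β')} + Σ_{α,α'} p_α η_{αα'} ∘ ψ(K̃)_{(μν)α'}. Then these operators satisfy the Poincaré algebra relations: [P̂_μ, P̂_ν] = 0, [M̂_{μν}, P̂_λ] = η_{νλ} P̂_μ - η_{μλ} P̂_ν, and [M̂_{μν}, M̂_{ρσ}] = η_{νρ} M̂_{μσ} - η_{μρ} M̂_{νσ} - η_{νσ} M̂_{μρ} + η_{μσ} M̂_{νρ}.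 -/
open MvPolynomial

/-- Index set: pair indices for `x_{μν}` (`μ < ν`) and single indices for `p_μ`. -/
abbrev PIdx (n : ℕ) := {q : Fin n × Fin n // q.1 < q.2} ⊕ Fin n

/-- The polynomial algebra `P = ℝ[x_{μν} (1 ≤ μ < ν ≤ n), p_μ (1 ≤ μ ≤ n)]`. -/
abbrev PolyP (n : ℕ) := MvPolynomial (PIdx n) ℝ

/-- The Minkowski metric `η = diag(-1,1,…,1)`. -/
def etaM {n : ℕ} (μ ν : Fin n) : ℝ :=
  if μ = ν then (if (μ : ℕ) = 0 then -1 else 1) else 0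

/-- The antisymmetric family of variables: `x_{νμ} = -x_{μν}`, `x_{μμ} = 0`. -/
noncomputable def xv {n : ℕ} (μ ν : Fin n) : PolyP n :=
  if h : μ < ν then X (Sum.inl ⟨(μ, ν), h⟩)
  else if h : ν < μ then - X (Sum.inl ⟨(ν, μ), h⟩) else 0

/-- The variables `p_μ`. -/
noncomputable def pvar {n : ℕ} (μ : Fin n) : PolyP n := X (Sum.inr μ)

/-- Derivations `∂_{μν}` with `[∂_{μν},x_{αβ}] = η_{μα}η_{νβ} - η_{μβ}η_{να}`,
`[∂_{μν},p_α] = 0`, and `∂_{νμ} = -∂_{μν}`. -/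
noncomputable def dpair {n : ℕ} (μ ν : Fin n) : PolyP n → PolyP n := fun p =>
  if h : μ < ν then (etaM μ μ * etaM ν ν) • pderiv (Sum.inl ⟨(μ, ν), h⟩) p
  else if h : ν < μ then - ((etaM μ μ * etaM ν ν) • pderiv (Sum.inl ⟨(ν, μ), h⟩) p) else 0

/-- Derivations `∂_μ` with `[∂_μ,p_ν] = η_{μν}` and `[∂_μ,x_{αβ}] = 0`. -/
noncomputable def dsingle {n : ℕ} (μ : Fin n) : PolyP n → PolyP n := fun p =>
  etaM μ μ • pderiv (Sum.inr μ) p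

/-- The block `C_{(μν)α} = η_{αμ}∂_ν - η_{αν}∂_μ` of `K̃`. -/
noncomputable def Cblock {n : ℕ} (μ ν α : Fin n) : PolyP n → PolyP n := fun p =>
  etaM α μ • dsingle ν p - etaM α ν • dsingle μ p

/-- The block `D_{(μν)(αβ)} = (1/2)(η_{μα}∂_{νβ} - η_{μβ}∂_{να} + η_{νβ}∂_{μα} - η_{να}∂_{μβ})`. -/
noncomputable def Dblock {n : ℕ} (μ ν α β : Fin n) : PolyP n → PolyP n := fun p =>
  (1/2 : ℝ) • (etaM μ α • dpair ν β p - etaM μ β • dpair ν α p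
    + etaM ν β • dpair μ α p - etaM ν α • dpair μ β p)

/-- Single-single block of `K̃^m`: the `η`-contracted powers of `A = [∂_{μν}]`,
`(A⁰)_{μν} = η_{μν}`, `(A^m)_{μν} = Σ (A^{m-1})_{μα} η_{αβ} A_{βν}`. -/
noncomputable def Apow {n : ℕ} : ℕ → Fin n → Fin n → (PolyP n → PolyP n)
  | 0 => fun μ ν p => etaM μ ν • p
  | m+1 => fun μ ν p => ∑ α, ∑ β, etaM α β • Apow m μ α (dpair β ν p)

/-- Pair-pair block of `K̃^m`: the `η`-contracted powers of `D`. -/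
noncomputable def Dpow {n : ℕ} : ℕ → Fin n → Fin n → Fin n → Fin n → (PolyP n → PolyP n)
  | 0 => fun μ ν α β p => ((1/2 : ℝ) * (etaM μ α * etaM ν β - etaM μ β * etaM ν α)) • p
  | m+1 => fun μ ν α β p => ∑ lam, ∑ ρ, ∑ lam', ∑ ρ',
      (etaM lam lam' * etaM ρ ρ') • Dblock μ ν lam ρ (Dpow m lam' ρ' α β p)

/-- Pair-single block of `K̃^m` (equal to `Σ_{k=0}^{m-1} D^k C A^{m-k-1}`), computed
recursively by `LL(0) = 0`, `LL(m+1) = C·η·A^m + D·η·η·LL(m)`. -/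
noncomputable def LLpow {n : ℕ} : ℕ → Fin n → Fin n → Fin n → (PolyP n → PolyP n)
  | 0 => fun _ _ _ _ => 0
  | m+1 => fun μ ν α p =>
      (∑ lam, ∑ lam', etaM lam lam' • Cblock μ ν lam (Apow m lam' α p))
        + ∑ θ, ∑ σ, ∑ θ', ∑ σ',
            (etaM θ θ' * etaM σ σ') • Dblock μ ν θ σ (LLpow m θ' σ' α p)

/-- The coefficient `(-1)^k B_k / k!` of `ψ(t) = t/(1-e^{-t})` (`B₁ = -1/2`). -/
noncomputable def bcoef (k : ℕ) : ℝ := (-1 : ℝ)^k * ((bernoulli k : ℚ) : ℝ) / (k.factorial : ℝ)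

/-- `ψ(K̃)` on the single-single block. -/
noncomputable def psiA {n : ℕ} (μ ν : Fin n) : PolyP n → PolyP n := fun p =>
  ∑ᶠ k : ℕ, bcoef k • Apow k μ ν p

/-- `ψ(K̃)` on the pair-pair block. -/
noncomputable def psiD {n : ℕ} (μ ν α β : Fin n) : PolyP n → PolyP n := fun p =>
  ∑ᶠ k : ℕ, bcoef k • Dpow k μ ν α β p

/-- `ψ(K̃)` on the pair-single block. -/
noncomputable def psiLL {n : ℕ} (μ ν α : Fin n) : PolyP n → PolyP n := fun p =>
  ∑ᶠ k : ℕ, bcoef k • LLpow k μ ν α p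

/-- `P̂_μ = Σ_{α,α'} p_α η_{αα'} ∘ ψ(K̃)_{μα'}`. -/
noncomputable def Phat {n : ℕ} (μ : Fin n) : PolyP n → PolyP n := fun p =>
  ∑ α, ∑ α', etaM α α' • (pvar α * psiA μ α' p)

/-- `M̂_{μν} = Σ x_{αβ} η_{αα'} η_{ββ'} ∘ ψ(K̃)_{(μν)(α'β')} + Σ p_α η_{αα'} ∘ ψ(K̃)_{(μν)α'}`. -/
noncomputable def Mhat {n : ℕ} (μ ν : Fin n) : PolyP n → PolyP n := fun p =>
  (∑ α, ∑ β, ∑ α', ∑ β', (etaM α α' * etaM β β') • (xv α β * psiD μ ν α' β' p))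
    + ∑ α, ∑ α', etaM α α' • (pvar α * psiLL μ ν α' p)

section StructureConstants

variable {R : Type*} [CommRing R] [Algebra ℝ R]

/-- A derivation of `R` acting coefficientwise on `R⟦X⟧`. -/
noncomputable def coeffDerivation (D : Derivation ℝ R R) :
    Derivation ℝ (PowerSeries R) (PowerSeries R) :=
  Derivation.mk'
    { toFun := fun f => PowerSeries.mk fun n => D (PowerSeries.coeff n f)
      map_add' := fun f g => by ext n; simp
      map_smul' := fun r f => by ext n; simp }
    (fun f g => by
      ext n
      simp only [LinearMap.coe_mk, AddHom.coe_mk, PowerSeries.coeff_mk, PowerSeries.coeff_mul,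
        map_sum, Derivation.leibniz, smul_eq_mul, map_add, Finset.sum_add_distrib]
      congr 1
      rw [← Finset.Nat.sum_antidiagonal_swap]
      simp)

@[simp] lemma coeff_coeffDerivation (D : Derivation ℝ R R) (f : PowerSeries R) (n : ℕ) :
    PowerSeries.coeff n (coeffDerivation D f) = D (PowerSeries.coeff n f) := by
  simp [coeffDerivation]

/-- The Euler derivation `X d/dX` of `R⟦X⟧`. -/
noncomputable def eulerDerivation : Derivation ℝ (PowerSeries R) (PowerSeries R) :=
  Derivation.mk'
    { toFun := fun f => PowerSeries.mk fun n => (n : R) * PowerSeries.coeff n f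
      map_add' := fun f g => by ext n; simp [mul_add]
      map_smul' := fun r f => by ext n; simp }
    (fun f g => by
      ext n
      simp only [LinearMap.coe_mk, AddHom.coe_mk, PowerSeries.coeff_mk, PowerSeries.coeff_mul,
        smul_eq_mul, map_add, Finset.mul_sum]
      rw [← Finset.Nat.sum_antidiagonal_swap (f := fun q : ℕ × ℕ =>
        PowerSeries.coeff q.1 g * ((q.2 : R) * PowerSeries.coeff q.2 f)),
        ← Finset.sum_add_distrib]
      refine Finset.sum_congr rfl fun q hq => ?_
      rw [← Finset.HasAntidiagonal.mem_antidiagonal.1 hq]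
      simp only [Prod.fst_swap, Prod.snd_swap]
      push_cast
      ring)

@[simp] lemma coeff_eulerDerivation (f : PowerSeries R) (n : ℕ) :
    PowerSeries.coeff n (eulerDerivation f) = n * PowerSeries.coeff n f := by
  simp [eulerDerivation]

variable {J : Type*} [Fintype J]

lemma eq_zero_of_eulerDerivation_add_self (K : Matrix J J R) (w : J → PowerSeries R)
    (hw : ∀ j, eulerDerivation (w j) + w j
      = - (PowerSeries.X * ∑ m, w m * PowerSeries.C (K m j))) : w = 0 := by
  have key : ∀ n j, PowerSeries.coeff n (w j) = 0 := by
    intro n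
    induction n with
    | zero =>
      intro j
      have h := congrArg (PowerSeries.coeff 0) (hw j)
      rwa [map_add, coeff_eulerDerivation, map_neg, PowerSeries.coeff_zero_X_mul, Nat.cast_zero,
        zero_mul, zero_add, neg_zero] at h
    | succ n ih =>
      intro j
      have h := congrArg (PowerSeries.coeff (n + 1)) (hw j)
      rw [map_add, coeff_eulerDerivation, map_neg, PowerSeries.coeff_succ_X_mul, map_sum,
        Finset.sum_eq_zero (fun m _ => by rw [PowerSeries.coeff_mul_C, ih, zero_mul]), neg_zero,
        ← nsmul_eq_mul, ← succ_nsmul, ← Nat.cast_smul_eq_nsmul ℝ] at h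
      exact (smul_eq_zero_iff_right (M := R) (by positivity : ((n + 1 + 1 : ℕ) : ℝ) ≠ 0)).1 h
  ext j n
  simp [key]

variable [DecidableEq J]

/-- The matrix `f(X K)` over `R⟦X⟧`. -/
noncomputable def matrixSeries (f : PowerSeries ℝ) (K : Matrix J J R) :
    Matrix J J (PowerSeries R) :=
  Matrix.of fun i j => PowerSeries.mk fun n => PowerSeries.coeff n f • (K ^ n) i j

lemma coeff_matrixSeries (f : PowerSeries ℝ) (K : Matrix J J R) (i j : J) (n : ℕ) :
    PowerSeries.coeff n (matrixSeries f K i j) = PowerSeries.coeff n f • (K ^ n) i j := by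
  simp [matrixSeries]

lemma matrixSeries_mul (f g : PowerSeries ℝ) (K : Matrix J J R) :
    matrixSeries f K * matrixSeries g K = matrixSeries (f * g) K := by
  ext i j n
  simp only [Matrix.mul_apply, map_sum, PowerSeries.coeff_mul, coeff_matrixSeries,
    Finset.sum_smul]
  rw [Finset.sum_comm]
  refine Finset.sum_congr rfl fun q hq => ?_
  rw [← Finset.HasAntidiagonal.mem_antidiagonal.1 hq, pow_add, Matrix.mul_apply, Finset.smul_sum]
  exact Finset.sum_congr rfl fun m _ => smul_mul_smul_comm _ _ _ _

lemma matrixSeries_one (K : Matrix J J R) : matrixSeries 1 K = 1 := by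
  ext i j n
  rw [coeff_matrixSeries, PowerSeries.coeff_one]
  rcases eq_or_ne i j with rfl | hij
  · rw [Matrix.one_apply_eq, PowerSeries.coeff_one]
    split_ifs with hn <;> simp [hn]
  · rw [Matrix.one_apply_ne hij]
    split_ifs with hn <;> simp [hn, hij]

/-- The power series `ψ(t) = t / (1 - e^{-t})`. -/
noncomputable def psiSeries : PowerSeries ℝ := PowerSeries.mk bcoef

/-- The power series `(1 - e^{-t}) / t`. -/
noncomputable def thetaSeries : PowerSeries ℝ :=
  PowerSeries.mk fun n => (-1) ^ n / ((n + 1).factorial : ℝ)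

lemma psiSeries_mul_thetaSeries : psiSeries * thetaSeries = 1 := by
  have h1 : psiSeries = PowerSeries.evalNegHom (bernoulliPowerSeries ℝ) := by
    ext n
    simp only [psiSeries, bcoef, PowerSeries.evalNegHom, PowerSeries.coeff_rescale,
      PowerSeries.coeff_mk, bernoulliPowerSeries]
    push_cast
    simp [mul_div_assoc]
  have h2 : thetaSeries * PowerSeries.X
      = - PowerSeries.evalNegHom (PowerSeries.exp ℝ - 1) := by
    ext n
    rcases n with _ | n
    · rw [map_neg, PowerSeries.evalNegHom, PowerSeries.coeff_rescale]
      simp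
    · simp [PowerSeries.evalNegHom, PowerSeries.coeff_rescale, thetaSeries,
        PowerSeries.coeff_succ_mul_X, PowerSeries.coeff_one, pow_succ, div_eq_mul_inv]
  have h3 := congrArg (PowerSeries.evalNegHom (A := ℝ))
    (bernoulliPowerSeries_mul_exp_sub_one ℝ)
  rw [map_mul, PowerSeries.evalNegHom_X, ← h1] at h3
  refine mul_right_cancel₀ (PowerSeries.X_ne_zero (R := ℝ)) ?_
  rw [mul_assoc, h2, mul_neg, h3, neg_neg, one_mul]

lemma eulerDerivation_theta (K : Matrix J J R) (i j : J) :
    eulerDerivation (matrixSeries thetaSeries K i j) + matrixSeries thetaSeries K i j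
      = (1 : Matrix J J (PowerSeries R)) i j
        - PowerSeries.X * ∑ m, matrixSeries thetaSeries K i m * PowerSeries.C (K m j) := by
  have h1 (n : ℕ) : PowerSeries.coeff n ((1 : Matrix J J (PowerSeries R)) i j)
      = if n = 0 then (1 : Matrix J J R) i j else 0 := by
    rcases eq_or_ne i j with rfl | hij
    · rw [Matrix.one_apply_eq, Matrix.one_apply_eq, PowerSeries.coeff_one]
    · rw [Matrix.one_apply_ne hij, Matrix.one_apply_ne hij, map_zero, ite_self]
  ext n
  rw [map_add, map_sub, h1, coeff_eulerDerivation, coeff_matrixSeries]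
  rcases n with _ | n
  · simp [thetaSeries]
  · rw [PowerSeries.coeff_succ_X_mul, map_sum]
    simp only [PowerSeries.coeff_mul_C, coeff_matrixSeries, smul_mul_assoc, ← Finset.smul_sum]
    rw [← Matrix.mul_apply, ← pow_succ, if_neg (Nat.succ_ne_zero n), zero_sub, ← neg_smul,
      ← nsmul_eq_mul, ← Nat.cast_smul_eq_nsmul ℝ, smul_smul, ← add_smul]
    congr 1
    have := Nat.factorial_ne_zero n
    have h2 : ((n + 1 : ℕ) : ℝ) + 1 ≠ 0 := by positivity
    simp only [thetaSeries, PowerSeries.coeff_mk, Nat.factorial_succ (n + 1)]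
    push_cast at h2 ⊢
    field_simp
    ring

/-- The rows of `(1 - e^{-K})/K` satisfy the Maurer–Cartan equation. -/
lemma maurerCartan_theta {D : J → Derivation ℝ R R} {K : Matrix J J R} {c : J → J → J → ℝ}
    (hanti : ∀ a b j, c a b j = - c b a j)
    (hD : ∀ a i j, D a (K i j) = algebraMap ℝ R (c i a j))
    (hjac : ∀ a b j, ∑ m, c m b j • K a m + ∑ m, c a m j • K b m = ∑ m, c a b m • K m j)
    (a b j : J) :
    coeffDerivation (D a) (matrixSeries thetaSeries K b j)
      - coeffDerivation (D b) (matrixSeries thetaSeries K a j)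
      = PowerSeries.X * ∑ m, ∑ n, algebraMap ℝ (PowerSeries R) (c m n j) *
          (matrixSeries thetaSeries K a m * matrixSeries thetaSeries K b n) := by
  set θ := matrixSeries thetaSeries K with hθ
  have hODE : ∀ i j, eulerDerivation (θ i j) + θ i j
      = (1 : Matrix J J (PowerSeries R)) i j - PowerSeries.X * ∑ m, θ i m * PowerSeries.C (K m j) :=
    eulerDerivation_theta K
  clear_value θ
  set γ : J → J → J → PowerSeries R := fun m n j => algebraMap ℝ (PowerSeries R) (c m n j) with hγ
  have hEX : eulerDerivation (PowerSeries.X : PowerSeries R) = PowerSeries.X := by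
    ext n
    rw [coeff_eulerDerivation, PowerSeries.coeff_X]
    split_ifs with h <;> simp [h]
  have hDX (a : J) : coeffDerivation (D a) (PowerSeries.X : PowerSeries R) = 0 := by
    ext n
    rw [coeff_coeffDerivation, PowerSeries.coeff_X]
    split_ifs <;> simp
  have hcomm (a : J) (f : PowerSeries R) :
      eulerDerivation (coeffDerivation (D a) f) = coeffDerivation (D a) (eulerDerivation f) := by
    ext n
    simp
  have hDK (a m j : J) : coeffDerivation (D a) (PowerSeries.C (K m j)) = γ m a j := by
    ext n
    simp only [hγ]
    rw [coeff_coeffDerivation, PowerSeries.coeff_C, PowerSeries.algebraMap_apply,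
      PowerSeries.coeff_C]
    split_ifs <;> simp [hD]
  have hanti' (a b j : J) : γ a b j = - γ b a j := by simp only [hγ]; rw [hanti, map_neg]
  have hjac' (a b j : J) : ∑ m, γ m b j * PowerSeries.C (K a m)
      + ∑ m, γ a m j * PowerSeries.C (K b m) = ∑ m, γ a b m * PowerSeries.C (K m j) := by
    have := congrArg (PowerSeries.C (R := R)) (hjac a b j)
    simpa only [map_add, map_sum, Algebra.smul_def, map_mul, hγ, PowerSeries.algebraMap_apply]
      using this
  have h1 (a b j : J) : eulerDerivation (coeffDerivation (D a) (θ b j))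
      + coeffDerivation (D a) (θ b j)
      = - (PowerSeries.X * ∑ m, coeffDerivation (D a) (θ b m) * PowerSeries.C (K m j))
        - PowerSeries.X * ∑ m, θ b m * γ m a j := by
    have h1' : coeffDerivation (D a) ((1 : Matrix J J (PowerSeries R)) b j) = 0 := by
      rw [Matrix.one_apply]; split_ifs <;> simp
    rw [hcomm, ← map_add, hODE, map_sub, h1', Derivation.leibniz, hDX, map_sum]
    simp only [Derivation.leibniz, hDK, smul_eq_mul, Finset.sum_add_distrib]
    simp only [mul_comm (PowerSeries.C _)]
    ring
  set Q : J → PowerSeries R := fun j => ∑ m, ∑ n, γ m n j * (θ a m * θ b n) with hQ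
  have h2 (j : J) : eulerDerivation (Q j) + 2 * Q j
      = ∑ n, γ a n j * θ b n + ∑ m, γ m b j * θ a m
        - PowerSeries.X * ∑ m, Q m * PowerSeries.C (K m j) := by
    have e1 : eulerDerivation (Q j) + 2 * Q j = ∑ m, ∑ n, γ m n j *
        ((eulerDerivation (θ a m) + θ a m) * θ b n +
          θ a m * (eulerDerivation (θ b n) + θ b n)) := by
      simp only [hQ, hγ, map_sum, Derivation.leibniz, Derivation.map_algebraMap, smul_eq_mul,
        Finset.mul_sum, ← Finset.sum_add_distrib]
      exact Finset.sum_congr rfl fun m _ => Finset.sum_congr rfl fun n _ => by ring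
    have e2 : ∑ m, ∑ n, γ m n j * ((1 : Matrix J J (PowerSeries R)) a m * θ b n)
        = ∑ n, γ a n j * θ b n := by
      rw [Finset.sum_eq_single a (fun m _ hm => by simp [Matrix.one_apply_ne hm.symm]) (by simp)]
      simp
    have e3 : ∑ m, ∑ n, γ m n j * (θ a m * (1 : Matrix J J (PowerSeries R)) b n)
        = ∑ m, γ m b j * θ a m := by
      refine Finset.sum_congr rfl fun m _ => ?_
      rw [Finset.sum_eq_single b (fun n _ hn => by simp [Matrix.one_apply_ne hn.symm]) (by simp)]
      simp
    have e4 : ∑ m, ∑ n, γ m n j * ((∑ r, θ a r * PowerSeries.C (K r m)) * θ b n)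
        = ∑ r, ∑ n, (θ a r * θ b n) * ∑ m, γ m n j * PowerSeries.C (K r m) := by
      simp only [Finset.mul_sum, Finset.sum_mul]
      rw [Finset.sum_comm, Finset.sum_comm (s := Finset.univ (α := J)) (t := Finset.univ (α := J))
        (f := fun r n => ∑ m, (θ a r * θ b n) * (γ m n j * PowerSeries.C (K r m)))]
      refine Finset.sum_congr rfl fun n _ => ?_
      rw [Finset.sum_comm]
      exact Finset.sum_congr rfl fun r _ => Finset.sum_congr rfl fun m _ => by ring
    have e5 : ∑ m, ∑ n, γ m n j * (θ a m * ∑ r, θ b r * PowerSeries.C (K r n))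
        = ∑ r, ∑ n, (θ a r * θ b n) * ∑ m, γ r m j * PowerSeries.C (K n m) := by
      simp only [Finset.mul_sum]
      refine Finset.sum_congr rfl fun r _ => ?_
      rw [Finset.sum_comm]
      exact Finset.sum_congr rfl fun n _ => Finset.sum_congr rfl fun m _ => by ring
    have e6 : ∑ m, Q m * PowerSeries.C (K m j)
        = ∑ r, ∑ n, (θ a r * θ b n) * ∑ m, γ r n m * PowerSeries.C (K m j) := by
      simp only [hQ, Finset.mul_sum, Finset.sum_mul]
      rw [Finset.sum_comm]
      refine Finset.sum_congr rfl fun r _ => ?_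
      rw [Finset.sum_comm]
      exact Finset.sum_congr rfl fun n _ => Finset.sum_congr rfl fun m _ => by ring
    have e7 : ∑ m, ∑ n, γ m n j *
        ((eulerDerivation (θ a m) + θ a m) * θ b n + θ a m * (eulerDerivation (θ b n) + θ b n))
        = ∑ m, ∑ n, γ m n j * ((1 : Matrix J J (PowerSeries R)) a m * θ b n)
          + ∑ m, ∑ n, γ m n j * (θ a m * (1 : Matrix J J (PowerSeries R)) b n)
          - PowerSeries.X *
            (∑ m, ∑ n, γ m n j * ((∑ r, θ a r * PowerSeries.C (K r m)) * θ b n)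
              + ∑ m, ∑ n, γ m n j * (θ a m * ∑ r, θ b r * PowerSeries.C (K r n))) := by
      rw [← Finset.sum_add_distrib, ← Finset.sum_add_distrib, Finset.mul_sum,
        ← Finset.sum_sub_distrib]
      refine Finset.sum_congr rfl fun m _ => ?_
      rw [← Finset.sum_add_distrib, ← Finset.sum_add_distrib, Finset.mul_sum,
        ← Finset.sum_sub_distrib]
      refine Finset.sum_congr rfl fun n _ => ?_
      rw [hODE, hODE]
      ring
    rw [e1, e7, e2, e3, e4, e5, e6]
    simp only [← Finset.sum_add_distrib, ← mul_add, ← hjac']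
  have hΩ := eq_zero_of_eulerDerivation_add_self K
    (fun j => coeffDerivation (D a) (θ b j) - coeffDerivation (D b) (θ a j) - PowerSeries.X * Q j)
    (fun j => by
      have e1 : ∑ n, γ a n j * θ b n = - ∑ m, θ b m * γ m a j := by
        rw [← Finset.sum_neg_distrib]
        exact Finset.sum_congr rfl fun m _ => by rw [hanti' a m j]; ring
      have e2 : ∑ m, γ m b j * θ a m = ∑ m, θ a m * γ m b j :=
        Finset.sum_congr rfl fun m _ => mul_comm _ _
      have e3 : ∑ m, PowerSeries.X * Q m * PowerSeries.C (K m j)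
          = PowerSeries.X * ∑ m, Q m * PowerSeries.C (K m j) := by
        rw [Finset.mul_sum]
        exact Finset.sum_congr rfl fun m _ => mul_assoc _ _ _
      simp only [map_sub, Derivation.leibniz, hEX, smul_eq_mul, sub_mul, Finset.sum_sub_distrib, e3]
      linear_combination h1 a b j - h1 b a j - PowerSeries.X * h2 j - PowerSeries.X * (e1 + e2))
  exact sub_eq_zero.1 (congrFun hΩ j)

/-- The matrix `ψ(K)` satisfies the commutation relations with structure constants `c`. -/
lemma psi_structure_equation {D : J → Derivation ℝ R R} {K : Matrix J J R} {c : J → J → J → ℝ}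
    (hanti : ∀ a b j, c a b j = - c b a j)
    (hD : ∀ a i j, D a (K i j) = algebraMap ℝ R (c i a j))
    (hjac : ∀ a b j, ∑ m, c m b j • K a m + ∑ m, c a m j • K b m = ∑ m, c a b m • K m j)
    (i k j : J) :
    ∑ l, (coeffDerivation (D l) (matrixSeries psiSeries K i j) * matrixSeries psiSeries K k l
        - coeffDerivation (D l) (matrixSeries psiSeries K k j) * matrixSeries psiSeries K i l)
      = PowerSeries.X * ∑ m, algebraMap ℝ (PowerSeries R) (c i k m) *
          matrixSeries psiSeries K m j := by
  have hMC := maurerCartan_theta hanti hD hjac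
  have hφθ : matrixSeries psiSeries K * matrixSeries thetaSeries K = 1 := by
    rw [matrixSeries_mul, psiSeries_mul_thetaSeries, matrixSeries_one]
  have hθφ : matrixSeries thetaSeries K * matrixSeries psiSeries K = 1 := by
    rw [matrixSeries_mul, mul_comm, psiSeries_mul_thetaSeries, matrixSeries_one]
  generalize matrixSeries psiSeries K = φ at *
  generalize matrixSeries thetaSeries K = θ at *
  have hφθ' (i j : J) : ∑ m, φ i m * θ m j = (1 : Matrix J J (PowerSeries R)) i j := by
    rw [← hφθ, Matrix.mul_apply]
  have hδ (l : J) : φ.map (coeffDerivation (D l)) = - (φ * θ.map (coeffDerivation (D l)) * φ) := by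
    have h : φ.map (coeffDerivation (D l)) * θ + φ * θ.map (coeffDerivation (D l)) = 0 := by
      ext1 i j
      have h := congrArg (coeffDerivation (D l)) (hφθ' i j)
      have h1' : coeffDerivation (D l) ((1 : Matrix J J (PowerSeries R)) i j) = 0 := by
        rw [Matrix.one_apply]; split_ifs <;> simp
      rw [h1', map_sum] at h
      simp only [Derivation.leibniz, smul_eq_mul, Finset.sum_add_distrib] at h
      simp only [Matrix.add_apply, Matrix.mul_apply, Matrix.map_apply, Matrix.zero_apply]
      rw [← h, add_comm]
      congr 1
      exact Finset.sum_congr rfl fun m _ => mul_comm _ _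
    rw [eq_neg_of_add_eq_zero_right h, neg_mul, neg_neg, mul_assoc, hθφ, mul_one]
  have hδ' (l i j : J) : coeffDerivation (D l) (φ i j)
      = - ∑ b, (∑ a, φ i a * coeffDerivation (D l) (θ a b)) * φ b j := by
    have := congrFun (congrFun (hδ l) i) j
    simpa [Matrix.mul_apply] using this
  have hW : ∀ b, ∑ l, (φ k l * ∑ a, φ i a * coeffDerivation (D l) (θ a b))
      - ∑ l, (φ i l * ∑ a, φ k a * coeffDerivation (D l) (θ a b))
      = PowerSeries.X * algebraMap ℝ (PowerSeries R) (c k i b) := by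
    intro b
    have e1 : ∑ l, (φ i l * ∑ a, φ k a * coeffDerivation (D l) (θ a b))
        = ∑ l, ∑ a, φ k l * φ i a * coeffDerivation (D a) (θ l b) := by
      simp only [Finset.mul_sum]
      rw [Finset.sum_comm]
      exact Finset.sum_congr rfl fun r _ => Finset.sum_congr rfl fun m _ => by ring
    have e2 : ∑ l, (φ k l * ∑ a, φ i a * coeffDerivation (D l) (θ a b))
        = ∑ l, ∑ a, φ k l * φ i a * coeffDerivation (D l) (θ a b) := by
      simp only [Finset.mul_sum, mul_assoc]
    have e3 : ∑ l, ∑ a, φ k l * φ i a * ∑ m, ∑ n, algebraMap ℝ (PowerSeries R) (c m n b) *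
        (θ l m * θ a n) = ∑ m, ∑ n, algebraMap ℝ (PowerSeries R) (c m n b) *
          ((∑ l, φ k l * θ l m) * ∑ a, φ i a * θ a n) := by
      simp only [Finset.mul_sum, Finset.sum_mul]
      have h4 (F : J → J → J → J → PowerSeries R) :
          ∑ l, ∑ a, ∑ m, ∑ n, F l a m n = ∑ m, ∑ n, ∑ a, ∑ l, F l a m n := by
        have := Finset.sum_comm (s := (Finset.univ : Finset (J × J)))
          (t := (Finset.univ : Finset (J × J))) (f := fun q r => F q.2 q.1 r.1 r.2)
        simp only [Fintype.sum_prod_type] at this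
        rw [← this, Finset.sum_comm]
      rw [h4]
      exact Finset.sum_congr rfl fun m _ => Finset.sum_congr rfl fun n _ =>
        Finset.sum_congr rfl fun a _ => Finset.sum_congr rfl fun l _ => by ring
    rw [e1, e2, ← Finset.sum_sub_distrib]
    simp only [← Finset.sum_sub_distrib, ← mul_sub, hMC]
    simp only [mul_left_comm _ PowerSeries.X, ← Finset.mul_sum]
    rw [e3]
    simp only [hφθ']
    congr 1
    rw [Finset.sum_eq_single k (fun m _ hm => by simp [Matrix.one_apply_ne hm.symm]) (by simp),
      Finset.sum_eq_single i (fun m _ hm => by simp [Matrix.one_apply_ne hm.symm]) (by simp)]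
    simp
  have e (i k : J) : ∑ l, coeffDerivation (D l) (φ i j) * φ k l
      = - ∑ b, (∑ l, φ k l * ∑ a, φ i a * coeffDerivation (D l) (θ a b)) * φ b j := by
    simp only [hδ', Finset.sum_mul, neg_mul, Finset.sum_neg_distrib]
    rw [Finset.sum_comm]
    refine congrArg Neg.neg (Finset.sum_congr rfl fun b _ => Finset.sum_congr rfl fun l _ => ?_)
    simp only [Finset.mul_sum, Finset.sum_mul]
    exact Finset.sum_congr rfl fun a _ => by ring
  rw [Finset.sum_sub_distrib, e, e, neg_sub_neg, ← Finset.sum_sub_distrib, Finset.mul_sum]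
  refine Finset.sum_congr rfl fun b _ => ?_
  rw [← sub_mul, ← neg_sub, hW, hanti, map_neg]
  ring

end StructureConstants

section DifferentialOperators

variable {σ : Type*}

lemma pderiv_comm (i j : σ) (p : MvPolynomial σ ℝ) :
    pderiv i (pderiv j p) = pderiv j (pderiv i p) := by
  classical
  have h : ⁅(pderiv i : Derivation ℝ (MvPolynomial σ ℝ) (MvPolynomial σ ℝ)),
      (pderiv j : Derivation ℝ (MvPolynomial σ ℝ) (MvPolynomial σ ℝ))⁆ = 0 := by
    refine MvPolynomial.derivation_ext fun k => ?_
    rw [Derivation.commutator_apply, pderiv_X, pderiv_X]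
    simp [Pi.single_apply, apply_ite]
  have hp := DFunLike.congr_fun h p
  rwa [Derivation.commutator_apply, Derivation.zero_apply, sub_eq_zero] at hp

open scoped IsMulCommutative in
/-- The differential operator with constant coefficients `q(∂)` attached to a polynomial `q`. -/
noncomputable def diffOp : MvPolynomial σ ℝ →ₐ[ℝ] Module.End ℝ (MvPolynomial σ ℝ) :=
  let s : Set (Module.End ℝ (MvPolynomial σ ℝ)) :=
    Set.range fun i : σ =>
      (pderiv i : Derivation ℝ (MvPolynomial σ ℝ) (MvPolynomial σ ℝ)).toLinearMap
  have hs : ∀ a ∈ s, ∀ b ∈ s, a * b = b * a := by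
    rintro _ ⟨i, rfl⟩ _ ⟨j, rfl⟩
    exact LinearMap.ext (pderiv_comm i j)
  haveI := Algebra.isMulCommutative_adjoin ℝ hs
  (Algebra.adjoin ℝ s).val.comp
    (aeval fun i => (⟨_, Algebra.subset_adjoin ⟨i, rfl⟩⟩ : Algebra.adjoin ℝ s))

@[simp] lemma diffOp_X (i : σ) (p : MvPolynomial σ ℝ) : diffOp (X i) p = pderiv i p := by
  simp [diffOp]

lemma diffOp_X_mul (l : σ) (q p : MvPolynomial σ ℝ) :
    diffOp q (X l * p) = X l * diffOp q p + diffOp (pderiv l q) p := by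
  classical
  induction q using MvPolynomial.induction_on generalizing p with
  | C a => simp [← MvPolynomial.algebraMap_eq, Algebra.smul_def, mul_left_comm]
  | add q r hq hr => simp only [map_add, LinearMap.add_apply, hq, hr]; ring
  | mul_X q i hq =>
    rw [mul_comm q]
    simp only [map_mul, Module.End.mul_apply, diffOp_X, Derivation.leibniz, smul_eq_mul,
      map_add, LinearMap.add_apply, hq, pderiv_X, Pi.single_apply]
    rcases eq_or_ne l i with rfl | h
    · simp
      ring
    · simp [h, h.symm]

/-- The polynomials of total degree less than `N`. -/
def degreeBelow (σ : Type*) (N : ℕ) : Submodule ℝ (MvPolynomial σ ℝ) where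
  carrier := {p | ∀ m : σ →₀ ℕ, N ≤ m.degree → coeff m p = 0}
  add_mem' hp hq m hm := by rw [coeff_add, hp m hm, hq m hm, add_zero]
  zero_mem' m _ := coeff_zero m
  smul_mem' r p hp m hm := by rw [coeff_smul, hp m hm, smul_zero]

lemma diffOp_mem_degreeBelow {q : MvPolynomial σ ℝ}
    (hq : q ∈ Submodule.span ℝ (Set.range (X : σ → MvPolynomial σ ℝ))) {N : ℕ}
    {p : MvPolynomial σ ℝ} (hp : p ∈ degreeBelow σ (N + 1)) : diffOp q p ∈ degreeBelow σ N := by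
  induction hq using Submodule.span_induction with
  | mem q hq =>
    obtain ⟨i, rfl⟩ := hq
    intro m hm
    rw [diffOp_X, coeff_pderiv, hp _ (by simpa using hm), zero_mul]
  | zero => simp
  | add q r _ _ hq hr => simpa using Submodule.add_mem _ hq hr
  | smul a q _ hq => simpa using Submodule.smul_mem _ a hq

variable {J : Type*} [Fintype J] [DecidableEq J]

lemma exists_forall_diffOp_pow_eq_zero {K : Matrix J J (MvPolynomial σ ℝ)}
    (hK : ∀ i j, K i j ∈ Submodule.span ℝ (Set.range (X : σ → MvPolynomial σ ℝ)))
    (p : MvPolynomial σ ℝ) : ∃ N, ∀ k ≥ N, ∀ i j, diffOp ((K ^ k) i j) p = 0 := by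
  have key : ∀ N, ∀ p ∈ degreeBelow σ N, ∀ k ≥ N, ∀ i j, diffOp ((K ^ k) i j) p = 0 := by
    intro N
    induction N with
    | zero =>
      intro p hp k _ i j
      have : p = 0 := by
        ext m
        exact hp m (Nat.zero_le _)
      rw [this, map_zero]
    | succ N ih =>
      intro p hp k hk i j
      obtain ⟨k, rfl⟩ : ∃ l, k = l + 1 := ⟨k - 1, by omega⟩
      rw [pow_succ, Matrix.mul_apply, map_sum, LinearMap.sum_apply]
      refine Finset.sum_eq_zero fun m _ => ?_
      rw [map_mul, Module.End.mul_apply]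
      exact ih _ (diffOp_mem_degreeBelow (hK m j) hp) k (by omega) i m
  refine ⟨p.totalDegree + 1, key _ p fun m hm => ?_⟩
  by_contra h
  have := le_totalDegree (mem_support_iff.2 h)
  exact absurd hm (by rw [not_le, Nat.lt_succ_iff]; exact this)

/-- The degree `k` part of `∑ j, x_j ψ(K)_{ij}`. -/
noncomputable def realizationPart (x : J → MvPolynomial σ ℝ) (K : Matrix J J (MvPolynomial σ ℝ))
    (k : ℕ) (i : J) : Module.End ℝ (MvPolynomial σ ℝ) :=
  ∑ j, LinearMap.mulLeft ℝ (x j) * diffOp (bcoef k • (K ^ k) i j)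

/-- The operator `∑ j, x_j ψ(K)_{ij}`. -/
noncomputable def realization (x : J → MvPolynomial σ ℝ) (K : Matrix J J (MvPolynomial σ ℝ))
    (i : J) (p : MvPolynomial σ ℝ) : MvPolynomial σ ℝ :=
  ∑ᶠ k, realizationPart x K k i p

lemma realizationPart_apply (x : J → MvPolynomial σ ℝ) (K : Matrix J J (MvPolynomial σ ℝ))
    (k : ℕ) (i : J) (p : MvPolynomial σ ℝ) :
    realizationPart x K k i p = ∑ j, x j * diffOp (bcoef k • (K ^ k) i j) p := by
  simp [realizationPart, LinearMap.sum_apply]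

lemma realizationPart_zero (x : J → MvPolynomial σ ℝ) (K : Matrix J J (MvPolynomial σ ℝ))
    (i : J) (p : MvPolynomial σ ℝ) : realizationPart x K 0 i p = bcoef 0 • (x i * p) := by
  rw [realizationPart_apply, Finset.sum_eq_single i
    (fun j _ h => by rw [pow_zero, Matrix.one_apply_ne h.symm]; simp) (by simp)]
  simp

lemma finsum_eq_sum_range {M : Type*} [AddCommMonoid M] {f : ℕ → M} {N : ℕ}
    (h : ∀ k ≥ N, f k = 0) : ∑ᶠ k, f k = ∑ k ∈ Finset.range N, f k :=
  finsum_eq_sum_of_support_subset _ fun k hk => by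
    by_contra hk'
    exact hk (h k (by simpa using hk'))

lemma sum_range_antidiagonal {M : Type*} [AddCommMonoid M] {G : ℕ → ℕ → M} {N : ℕ}
    (h : ∀ a b, N ≤ a ∨ N ≤ b → G a b = 0) :
    ∑ a ∈ Finset.range N, ∑ b ∈ Finset.range N, G a b
      = ∑ n ∈ Finset.range (2 * N + 1), ∑ q ∈ Finset.HasAntidiagonal.antidiagonal n, G q.1 q.2 := by
  rw [← Finset.sum_product', ← Finset.sum_fiberwise_of_maps_to (g := fun q : ℕ × ℕ => q.1 + q.2)
    (t := Finset.range (2 * N + 1))]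
  · refine Finset.sum_congr rfl fun n _ => Finset.sum_subset ?_ ?_
    · intro q hq
      simpa using (Finset.mem_filter.1 hq).2
    · intro q hq hq'
      apply h
      by_contra hlt
      push Not at hlt
      exact hq' (by simpa [hlt] using hq)
  · intro q hq
    simp only [Finset.mem_product, Finset.mem_range] at hq ⊢
    omega

variable {x : J → MvPolynomial σ ℝ} {K : Matrix J J (MvPolynomial σ ℝ)}
  {D : J → Derivation ℝ (MvPolynomial σ ℝ) (MvPolynomial σ ℝ)} {c : J → J → J → ℝ}

lemma sum_antidiagonal_realizationPart
    (hx : ∀ l q p, diffOp q (x l * p) = x l * diffOp q p + diffOp (D l q) p)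
    (i k : J) (n : ℕ) (p : MvPolynomial σ ℝ) :
    ∑ q ∈ Finset.HasAntidiagonal.antidiagonal n,
      (realizationPart x K q.1 i (realizationPart x K q.2 k p)
        - realizationPart x K q.1 k (realizationPart x K q.2 i p))
      = ∑ j, x j * diffOp (PowerSeries.coeff n (∑ l,
          (coeffDerivation (D l) (matrixSeries psiSeries K i j) * matrixSeries psiSeries K k l
          - coeffDerivation (D l) (matrixSeries psiSeries K k j) *
            matrixSeries psiSeries K i l))) p := by
  set φ : ℕ → J → J → MvPolynomial σ ℝ := fun a i j => bcoef a • (K ^ a) i j with hφ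
  have hcoeff (a : ℕ) (i j : J) : PowerSeries.coeff a (matrixSeries psiSeries K i j) = φ a i j := by
    rw [coeff_matrixSeries, psiSeries, PowerSeries.coeff_mk]
  have e1 (a b : ℕ) (i k : J) : realizationPart x K a i (realizationPart x K b k p)
      = ∑ j, ∑ l, x j * (x l * diffOp (φ a i j * φ b k l) p)
        + ∑ j, x j * ∑ l, diffOp (D l (φ a i j) * φ b k l) p := by
    simp only [realizationPart_apply, map_sum, hx, map_mul, Module.End.mul_apply, hφ,
      mul_add, Finset.mul_sum, Finset.sum_add_distrib]
    rw [Finset.sum_comm, Finset.sum_comm (f := fun l j => x j * diffOp (D l _) _)]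
  have e2 (i k : J) : ∑ q ∈ Finset.HasAntidiagonal.antidiagonal n, ∑ j, ∑ l,
        x j * (x l * diffOp (φ q.1 i j * φ q.2 k l) p)
      = ∑ q ∈ Finset.HasAntidiagonal.antidiagonal n, ∑ j, ∑ l,
        x j * (x l * diffOp (φ q.1 k j * φ q.2 i l) p) := by
    rw [← Finset.Nat.sum_antidiagonal_swap]
    refine Finset.sum_congr rfl fun q _ => ?_
    rw [Finset.sum_comm]
    refine Finset.sum_congr rfl fun j _ => Finset.sum_congr rfl fun l _ => ?_
    rw [mul_left_comm, mul_comm (φ _ _ _)]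
    rfl
  have e3 (i k : J) : ∑ q ∈ Finset.HasAntidiagonal.antidiagonal n, ∑ j, x j * ∑ l,
        diffOp (D l (φ q.1 i j) * φ q.2 k l) p
      = ∑ j, x j * diffOp (PowerSeries.coeff n (∑ l,
          coeffDerivation (D l) (matrixSeries psiSeries K i j) *
            matrixSeries psiSeries K k l)) p := by
    simp only [map_sum, PowerSeries.coeff_mul, coeff_coeffDerivation, hcoeff, LinearMap.sum_apply,
      Finset.mul_sum]
    rw [Finset.sum_comm]
    exact Finset.sum_congr rfl fun j _ => Finset.sum_comm
  simp only [e1, Finset.sum_sub_distrib, Finset.sum_add_distrib, map_sub, LinearMap.sub_apply,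
    mul_sub, e3]
  rw [e2 i k]
  abel

/-- The operators `∑ j, x_j ψ(K)_{ij}` realize the Lie algebra with structure constants `c`. -/
theorem realization_commutator
    (hx : ∀ l q p, diffOp q (x l * p) = x l * diffOp q p + diffOp (D l q) p)
    (hK : ∀ i j, K i j ∈ Submodule.span ℝ (Set.range (X : σ → MvPolynomial σ ℝ)))
    (hanti : ∀ a b j, c a b j = - c b a j)
    (hD : ∀ a i j, D a (K i j) = algebraMap ℝ _ (c i a j))
    (hjac : ∀ a b j, ∑ m, c m b j • K a m + ∑ m, c a m j • K b m = ∑ m, c a b m • K m j)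
    (i k : J) (p : MvPolynomial σ ℝ) :
    realization x K i (realization x K k p) - realization x K k (realization x K i p)
      = ∑ m, c i k m • realization x K m p := by
  have hnil (p : MvPolynomial σ ℝ) : ∃ N, ∀ a ≥ N, ∀ i, realizationPart x K a i p = 0 := by
    obtain ⟨N, hN⟩ := exists_forall_diffOp_pow_eq_zero hK p
    exact ⟨N, fun a ha i => by simp [realizationPart_apply, hN a ha]⟩
  obtain ⟨N₁, hN₁⟩ := hnil p
  choose B hB using fun q : ℕ × J => hnil (realizationPart x K q.1 q.2 p)
  set N := N₁ + ∑ q ∈ Finset.range N₁ ×ˢ (Finset.univ : Finset J), B q with hN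
  have hN' : ∀ a b, N ≤ a ∨ N ≤ b → ∀ i k,
      realizationPart x K a i (realizationPart x K b k p) = 0 := by
    intro a b hab i k
    by_cases hb : N₁ ≤ b
    · rw [hN₁ b hb, map_zero]
    · have : B (b, k) ≤ ∑ q ∈ Finset.range N₁ ×ˢ (Finset.univ : Finset J), B q :=
        Finset.single_le_sum (f := B) (fun _ _ => Nat.zero_le _) (by simpa using hb)
      exact hB (b, k) a (by omega) i
  have htotal (M : ℕ) (hM : N₁ ≤ M) (k : J) :
      realization x K k p = ∑ b ∈ Finset.range M, realizationPart x K b k p :=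
    finsum_eq_sum_range fun b hb => hN₁ b (hM.trans hb) k
  have hcomp (i k : J) : realization x K i (realization x K k p)
      = ∑ n ∈ Finset.range (2 * N + 1), ∑ q ∈ Finset.HasAntidiagonal.antidiagonal n,
        realizationPart x K q.1 i (realizationPart x K q.2 k p) := by
    rw [← sum_range_antidiagonal fun a b hab => hN' a b hab i k, htotal N (by omega) k,
      realization, finsum_eq_sum_range (N := N)]
    · simp only [map_sum]
    · intro a ha
      rw [map_sum]
      exact Finset.sum_eq_zero fun b _ => hN' a b (Or.inl ha) i k
  rw [hcomp, hcomp, ← Finset.sum_sub_distrib]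
  simp only [← Finset.sum_sub_distrib]
  simp only [sum_antidiagonal_realizationPart hx, psi_structure_equation hanti hD hjac]
  rw [Finset.sum_range_succ']
  simp only [PowerSeries.coeff_succ_X_mul, PowerSeries.coeff_zero_X_mul, map_zero,
    LinearMap.zero_apply, mul_zero, Finset.sum_const_zero, add_zero]
  simp only [htotal (2 * N) (by omega), Finset.smul_sum]
  rw [eq_comm, Finset.sum_comm]
  refine Finset.sum_congr rfl fun n _ => ?_
  simp only [realizationPart_apply, ← Algebra.smul_def, PowerSeries.coeff_smul, map_sum, map_smul,
    coeff_matrixSeries, psiSeries, PowerSeries.coeff_mk, LinearMap.sum_apply, LinearMap.smul_apply,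
    Finset.mul_sum, Finset.smul_sum, mul_smul_comm]
  rw [Finset.sum_comm]

end DifferentialOperators

section Poincare

variable {n : ℕ}

/-- Index set of the generators `M_{μν}` and `P_μ`. -/
abbrev GenIdx (n : ℕ) := (Fin n × Fin n) ⊕ Fin n

lemma etaM_mul_self (μ : Fin n) : etaM μ μ * etaM μ μ = 1 := by
  simp only [etaM, if_true]
  split_ifs <;> norm_num

lemma etaM_of_ne {μ ν : Fin n} (h : μ ≠ ν) : etaM μ ν = 0 := if_neg h

lemma etaM_eq_mul_ite (μ ν : Fin n) : etaM μ ν = etaM ν ν * if μ = ν then 1 else 0 := by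
  rcases eq_or_ne μ ν with rfl | h
  · simp
  · rw [etaM_of_ne h, if_neg h, mul_zero]

lemma etaM_comm (μ ν : Fin n) : etaM μ ν = etaM ν μ := by
  rcases eq_or_ne μ ν with rfl | h
  · rfl
  · rw [etaM_of_ne h, etaM_of_ne h.symm]

section Module

variable {M : Type*} [AddCommGroup M] [Module ℝ M]

lemma sum_etaM_smul (μ : Fin n) (f : Fin n → M) : ∑ ν, etaM μ ν • f ν = etaM μ μ • f μ := by
  rw [Finset.sum_eq_single μ (fun ν _ h => by rw [etaM_of_ne h.symm, zero_smul]) (by simp)]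

lemma sum_etaM_self_smul_etaM_smul (μ : Fin n) (f : Fin n → M) :
    ∑ ν, etaM ν ν • etaM μ ν • f ν = f μ := by
  rw [Finset.sum_eq_single μ (fun ν _ h => by rw [etaM_of_ne h.symm, zero_smul, smul_zero])
    (by simp), smul_smul, etaM_mul_self, one_smul]

/-- Antisymmetry in the pair indices. -/
def PairAntisymm (v : GenIdx n → M) : Prop :=
  ∀ μ ν, v (Sum.inl (μ, ν)) = - v (Sum.inl (ν, μ))

/-- The brackets of the Poincaré algebra, with the generators replaced by the family `v`. -/
def poincareBracket (v : GenIdx n → M) : GenIdx n → GenIdx n → M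
  | Sum.inl (μ, ν), Sum.inl (ρ, σ) => etaM ν ρ • v (Sum.inl (μ, σ)) - etaM μ ρ • v (Sum.inl (ν, σ))
      - etaM ν σ • v (Sum.inl (μ, ρ)) + etaM μ σ • v (Sum.inl (ν, ρ))
  | Sum.inl (μ, ν), Sum.inr ρ => etaM ν ρ • v (Sum.inr μ) - etaM μ ρ • v (Sum.inr ν)
  | Sum.inr ρ, Sum.inl (μ, ν) => etaM μ ρ • v (Sum.inr ν) - etaM ν ρ • v (Sum.inr μ)
  | Sum.inr _, Sum.inr _ => 0

/-- The projection onto the families antisymmetric in the pair indices. -/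
noncomputable def pairProj : GenIdx n → GenIdx n → ℝ
  | Sum.inl (μ, ν), Sum.inl (α, β) => (1 / 2 : ℝ) *
      ((if μ = α then 1 else 0) * (if ν = β then 1 else 0)
        - (if μ = β then 1 else 0) * (if ν = α then 1 else 0))
  | Sum.inl _, Sum.inr _ => 0
  | Sum.inr _, Sum.inl _ => 0
  | Sum.inr μ, Sum.inr α => if μ = α then 1 else 0

lemma pairProj_comm (i j : GenIdx n) : pairProj i j = pairProj j i := by
  rcases i with ⟨μ, ν⟩ | μ <;> rcases j with ⟨α, β⟩ | α <;>
    simp only [pairProj, eq_comm (a := μ)]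
  simp only [eq_comm (a := ν), mul_comm]

lemma pairAntisymm_pairProj (j : GenIdx n) : PairAntisymm fun i => pairProj i j := by
  intro μ ν
  rcases j with ⟨α, β⟩ | α <;> simp only [pairProj]
  · ring
  · simp

lemma sum_pairProj_smul {v : GenIdx n → M} (hv : PairAntisymm v) (i : GenIdx n) :
    ∑ j, pairProj i j • v j = v i := by
  rcases i with ⟨μ, ν⟩ | μ <;>
    simp only [pairProj, Fintype.sum_sum_type, Fintype.sum_prod_type, zero_smul,
      Finset.sum_const_zero, add_zero, zero_add, mul_smul, sub_smul, ite_smul, one_smul,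
      ← Finset.smul_sum, Finset.sum_sub_distrib, Finset.sum_ite_eq, Finset.mem_univ, if_true]
  have : ∑ x, ∑ y, (if μ = x then if ν = y then v (Sum.inl (x, y)) else 0 else 0)
      = v (Sum.inl (μ, ν)) := by simp
  rw [this, hv ν μ]
  module

/-- The structure constants of the Poincaré algebra. -/
noncomputable def poincareConst (i k j : GenIdx n) : ℝ :=
  poincareBracket (fun m => pairProj m j) i k

lemma sum_poincareConst_smul {v : GenIdx n → M} (hv : PairAntisymm v) (i k : GenIdx n) :
    ∑ j, poincareConst i k j • v j = poincareBracket v i k := by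
  rcases i with ⟨μ, ν⟩ | μ <;> rcases k with ⟨ρ, σ⟩ | ρ <;>
    simp only [poincareConst, poincareBracket, smul_eq_mul, add_smul, sub_smul, mul_smul,
      Finset.sum_add_distrib, Finset.sum_sub_distrib, ← Finset.smul_sum, sum_pairProj_smul hv,
      zero_smul, Finset.sum_const_zero]

lemma poincareBracket_swap {v : GenIdx n → M} (hv : PairAntisymm v) (i k : GenIdx n) :
    poincareBracket v i k = - poincareBracket v k i := by
  rcases i with ⟨μ, ν⟩ | μ <;> rcases k with ⟨ρ, σ⟩ | ρ <;> simp only [poincareBracket]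
  · rw [hv ρ ν, hv σ ν, hv ρ μ, hv σ μ, etaM_comm ρ, etaM_comm ρ, etaM_comm σ, etaM_comm σ]
    module
  · module
  · module
  · simp

lemma pairAntisymm_poincareBracket (v : GenIdx n → M) (k : GenIdx n) :
    PairAntisymm fun i => poincareBracket v i k := by
  intro μ ν
  rcases k with ⟨ρ, σ⟩ | ρ <;> simp only [poincareBracket] <;> module

/-- The matrix `K̃`, applied to a family `v` antisymmetric in the pair indices, with the family
`τ` in place of the derivatives. -/
def poincareOp (τ : GenIdx n → M) (v : GenIdx n → ℝ) : GenIdx n → M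
  | Sum.inl (μ, ν) => ∑ β, (etaM β β * v (Sum.inl (μ, β))) • τ (Sum.inl (ν, β))
      - ∑ β, (etaM β β * v (Sum.inl (ν, β))) • τ (Sum.inl (μ, β))
      + v (Sum.inr μ) • τ (Sum.inr ν) - v (Sum.inr ν) • τ (Sum.inr μ)
  | Sum.inr μ => ∑ β, (etaM β β * v (Sum.inr β)) • τ (Sum.inl (μ, β))

/-- The matrix `K̃` with the derivatives replaced by the family `τ`, and with the column indices
raised. -/
noncomputable def poincareMatrix (τ : GenIdx n → M) : Matrix (GenIdx n) (GenIdx n) M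
  | Sum.inl (μ, ν), Sum.inl (α, β) => (etaM α α * etaM β β) • (1 / 2 : ℝ) •
      (etaM μ α • τ (Sum.inl (ν, β)) - etaM μ β • τ (Sum.inl (ν, α))
        + etaM ν β • τ (Sum.inl (μ, α)) - etaM ν α • τ (Sum.inl (μ, β)))
  | Sum.inl (μ, ν), Sum.inr α => etaM α α •
      (etaM α μ • τ (Sum.inr ν) - etaM α ν • τ (Sum.inr μ))
  | Sum.inr _, Sum.inl _ => 0
  | Sum.inr μ, Sum.inr α => etaM α α • τ (Sum.inl (μ, α))

variable {τ : GenIdx n → M} {v : GenIdx n → ℝ}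

lemma sum_smul_poincareMatrix (hv : PairAntisymm v) (i : GenIdx n) :
    ∑ j, v j • poincareMatrix τ i j = poincareOp τ v i := by
  rcases i with ⟨μ, ν⟩ | μ
  · simp only [poincareMatrix, poincareOp, Fintype.sum_sum_type, Fintype.sum_prod_type]
    have e1 (μ : Fin n) (f : Fin n → Fin n → M) :
        ∑ α, ∑ β, (etaM α α * etaM μ α) • f α β = ∑ β, f μ β := by
      simp only [mul_smul, ← Finset.smul_sum, sum_etaM_self_smul_etaM_smul]
    have e2 (μ : Fin n) (f : Fin n → Fin n → M) :
        ∑ α, ∑ β, (etaM β β * etaM μ β) • f α β = ∑ α, f α μ := by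
      simp only [mul_smul, sum_etaM_self_smul_etaM_smul]
    have e3 : ∑ α, ∑ β, v (Sum.inl (α, β)) • (etaM α α * etaM β β) • (1 / 2 : ℝ) •
        (etaM μ α • τ (Sum.inl (ν, β)) - etaM μ β • τ (Sum.inl (ν, α))
          + etaM ν β • τ (Sum.inl (μ, α)) - etaM ν α • τ (Sum.inl (μ, β)))
        = ∑ α, ∑ β, (etaM α α * etaM μ α) • (1 / 2 * (etaM β β * v (Sum.inl (α, β)))) •
            τ (Sum.inl (ν, β))
          + ∑ α, ∑ β, (etaM β β * etaM μ β) • (1 / 2 * (etaM α α * v (Sum.inl (β, α)))) •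
            τ (Sum.inl (ν, α))
          - ∑ α, ∑ β, (etaM β β * etaM ν β) • (1 / 2 * (etaM α α * v (Sum.inl (β, α)))) •
            τ (Sum.inl (μ, α))
          - ∑ α, ∑ β, (etaM α α * etaM ν α) • (1 / 2 * (etaM β β * v (Sum.inl (α, β)))) •
            τ (Sum.inl (μ, β)) := by
      simp only [← Finset.sum_add_distrib, ← Finset.sum_sub_distrib]
      refine Finset.sum_congr rfl fun α _ => Finset.sum_congr rfl fun β _ => ?_
      rw [hv β α]
      module
    have e4 : ∑ α, v (Sum.inr α) • etaM α α •
        (etaM α μ • τ (Sum.inr ν) - etaM α ν • τ (Sum.inr μ))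
        = v (Sum.inr μ) • τ (Sum.inr ν) - v (Sum.inr ν) • τ (Sum.inr μ) := by
      simp only [smul_sub, smul_comm (v _), Finset.sum_sub_distrib, etaM_comm _ μ, etaM_comm _ ν,
        sum_etaM_self_smul_etaM_smul]
    rw [e3, e4, e1, e2, e2, e1]
    simp only [mul_smul, ← Finset.smul_sum]
    module
  · simp [poincareMatrix, poincareOp, Fintype.sum_sum_type, mul_smul, smul_comm (v _)]

lemma pairAntisymm_poincareMatrix_row (i : GenIdx n) : PairAntisymm (poincareMatrix τ i) := by
  intro α β
  rcases i with ⟨μ, ν⟩ | μ <;> simp only [poincareMatrix]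
  · module
  · simp

lemma pairAntisymm_poincareMatrix_col (j : GenIdx n) :
    PairAntisymm fun i => poincareMatrix τ i j := by
  intro μ ν
  rcases j with ⟨α, β⟩ | α <;> simp only [poincareMatrix] <;> module

lemma poincareMatrix_eq_poincareOp (i j : GenIdx n) :
    poincareMatrix τ i j = poincareOp τ (fun m => pairProj m j) i := by
  rw [← sum_smul_poincareMatrix (pairAntisymm_pairProj j)]
  simp only [pairProj_comm _ j]
  exact (sum_pairProj_smul (pairAntisymm_poincareMatrix_row i) j).symm

lemma poincareOp_poincareBracket (hτ : PairAntisymm τ) (hv : PairAntisymm v) (i k : GenIdx n) :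
    poincareOp τ (fun m => poincareBracket v m k) i -
      poincareOp τ (fun m => poincareBracket v m i) k
      = poincareBracket (poincareOp τ v) i k := by
  have hS (μ σ : Fin n) : ∑ β, (etaM β β * v (Sum.inl (β, σ))) • τ (Sum.inl (μ, β))
      = - ∑ β, (etaM β β * v (Sum.inl (σ, β))) • τ (Sum.inl (μ, β)) := by
    rw [← Finset.sum_neg_distrib]
    refine Finset.sum_congr rfl fun β _ => ?_
    rw [hv β σ]
    module
  have hδ (μ ν : Fin n) (a : ℝ) : ∑ β, (etaM β β * (etaM β ν * a)) • τ (Sum.inl (μ, β))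
      = a • τ (Sum.inl (μ, ν)) := by
    simp only [mul_smul, etaM_comm _ ν, sum_etaM_self_smul_etaM_smul]
  have hδ' (μ ν : Fin n) (a : ℝ) : ∑ β, (etaM β β * (etaM ν β * a)) • τ (Sum.inl (μ, β))
      = a • τ (Sum.inl (μ, ν)) := by
    simp only [mul_smul, sum_etaM_self_smul_etaM_smul]
  have hc (a : ℝ) (f : Fin n → ℝ) (g : Fin n → M) : ∑ β, (etaM β β * (a * f β)) • g β
      = a • ∑ β, (etaM β β * f β) • g β := by
    simp only [Finset.smul_sum, smul_smul]
    exact Finset.sum_congr rfl fun β _ => by rw [mul_left_comm]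
  rcases i with ⟨μ, ν⟩ | μ <;> rcases k with ⟨ρ, σ⟩ | ρ <;>
    simp only [poincareBracket, poincareOp, smul_eq_mul, mul_add, mul_sub, add_smul, sub_smul,
      Finset.sum_add_distrib, Finset.sum_sub_distrib, hδ, hδ', hc, hS]
  · rw [hv ρ ν, hv ρ μ, hv σ ν, hv σ μ, hτ σ μ, hτ σ ν, hτ ρ μ, hτ ρ ν, etaM_comm ρ, etaM_comm ρ,
      etaM_comm σ, etaM_comm σ]
    module
  · rw [hτ ρ μ, hτ ρ ν]
    module
  · rw [hτ σ μ, hτ ρ μ]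
    module
  · simp

lemma poincareMatrix_jacobi (hτ : PairAntisymm τ) (a b j : GenIdx n) :
    ∑ m, poincareConst m b j • poincareMatrix τ a m +
      ∑ m, poincareConst a m j • poincareMatrix τ b m
      = ∑ m, poincareConst a b m • poincareMatrix τ m j := by
  have h (k : GenIdx n) : PairAntisymm fun m => poincareConst m k j :=
    pairAntisymm_poincareBracket _ _
  have hswap (m : GenIdx n) : poincareConst a m j = - poincareConst m a j :=
    poincareBracket_swap (pairAntisymm_pairProj j) a m
  rw [sum_smul_poincareMatrix (h b), sum_poincareConst_smul (pairAntisymm_poincareMatrix_col j)]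
  simp only [hswap, neg_smul, Finset.sum_neg_distrib, sum_smul_poincareMatrix (h a)]
  simp only [poincareMatrix_eq_poincareOp]
  rw [← sub_eq_add_neg]
  exact poincareOp_poincareBracket hτ (pairAntisymm_pairProj j) a b

lemma map_poincareOp {M' : Type*} [AddCommGroup M'] [Module ℝ M'] (f : M →ₗ[ℝ] M')
    (i : GenIdx n) : f (poincareOp τ v i) = poincareOp (fun j => f (τ j)) v i := by
  rcases i with ⟨μ, ν⟩ | μ <;> simp [poincareOp]

lemma poincareMatrix_mem {S : Submodule ℝ M} (hS : ∀ i, τ i ∈ S) (i j : GenIdx n) :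
    poincareMatrix τ i j ∈ S := by
  rcases i with ⟨μ, ν⟩ | μ <;> rcases j with ⟨α, β⟩ | α <;> simp only [poincareMatrix]
  · have h (r : ℝ) (i : GenIdx n) : r • τ i ∈ S := S.smul_mem r (hS i)
    exact S.smul_mem _ (S.smul_mem _
      (S.sub_mem (S.add_mem (S.sub_mem (h _ _) (h _ _)) (h _ _)) (h _ _)))
  · exact S.smul_mem _ (S.sub_mem (S.smul_mem _ (hS _)) (S.smul_mem _ (hS _)))
  · exact S.zero_mem
  · exact S.smul_mem _ (hS _)

end Module
/-- The pairing of the derivatives with the coordinates. -/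
def metricPairing : GenIdx n → GenIdx n → ℝ
  | Sum.inl (ρ, σ), Sum.inl (α, β) => etaM ρ α * etaM σ β - etaM ρ β * etaM σ α
  | Sum.inl _, Sum.inr _ => 0
  | Sum.inr _, Sum.inl _ => 0
  | Sum.inr ρ, Sum.inr α => etaM ρ α

lemma poincareOp_metricPairing (v : GenIdx n → ℝ) (i a : GenIdx n) :
    poincareOp (metricPairing a) v i = poincareBracket v i a := by
  have h (σ : Fin n) (c : ℝ) (f : Fin n → ℝ) :
      ∑ β, etaM β β * f β * (c * etaM σ β) = c * f σ := by
    rw [← sum_etaM_self_smul_etaM_smul σ fun β => c * f β]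
    exact Finset.sum_congr rfl fun β _ => by simp only [smul_eq_mul]; ring
  have h' (σ : Fin n) (c : ℝ) (f : Fin n → ℝ) :
      ∑ β, etaM β β * f β * (etaM σ β * c) = c * f σ := by
    simp only [mul_comm _ c, h]
  rcases i with ⟨μ, ν⟩ | μ <;> rcases a with ⟨ρ, σ⟩ | ρ <;>
    simp only [poincareOp, metricPairing, poincareBracket, smul_eq_mul, mul_sub,
      Finset.sum_sub_distrib, h, h', mul_zero, Finset.sum_const_zero]
  · rw [etaM_comm ρ, etaM_comm ρ, etaM_comm σ, etaM_comm σ]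
    ring
  · rw [etaM_comm ρ, etaM_comm ρ]
    ring

/-- The generators of the polynomial algebra, with `x_{μν}` for all pairs of indices. -/
noncomputable def genVar : GenIdx n → PolyP n
  | Sum.inl (μ, ν) => xv μ ν
  | Sum.inr μ => pvar μ

/-- The symbols of the derivations `∂_{μν}` and `∂_μ`. -/
noncomputable def dualVar : GenIdx n → PolyP n
  | Sum.inl (μ, ν) => (etaM μ μ * etaM ν ν) • xv μ ν
  | Sum.inr μ => etaM μ μ • pvar μ

/-- The derivations with respect to the generators `x_{μν}` and `p_μ`. -/
noncomputable def genDeriv : GenIdx n → Derivation ℝ (PolyP n) (PolyP n)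
  | Sum.inl (μ, ν) =>
    if h : μ < ν then pderiv (Sum.inl ⟨(μ, ν), h⟩)
    else if h : ν < μ then - pderiv (Sum.inl ⟨(ν, μ), h⟩) else 0
  | Sum.inr μ => pderiv (Sum.inr μ)

lemma diffOp_genVar_mul (l : GenIdx n) (q p : PolyP n) :
    diffOp q (genVar l * p) = genVar l * diffOp q p + diffOp (genDeriv l q) p := by
  rcases l with ⟨μ, ν⟩ | μ <;> simp only [genVar, genDeriv, xv, pvar]
  · split_ifs
    · exact diffOp_X_mul _ _ _
    · simp only [neg_mul, map_neg, diffOp_X_mul, Derivation.neg_apply, LinearMap.neg_apply]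
      ring
    · simp
  · exact diffOp_X_mul _ _ _

lemma xv_swap (μ ν : Fin n) : xv μ ν = - xv ν μ := by
  rcases lt_trichotomy μ ν with h | rfl | h
  · simp [xv, h, h.not_gt]
  · simp [xv]
  · simp [xv, h, h.not_gt]

lemma pairAntisymm_genVar : PairAntisymm (genVar (n := n)) := xv_swap

lemma pairAntisymm_dualVar : PairAntisymm (dualVar (n := n)) := fun μ ν => by
  simp only [dualVar]
  rw [xv_swap, mul_comm, smul_neg]

lemma genDeriv_xv (ρ σ α β : Fin n) : genDeriv (Sum.inl (ρ, σ)) (xv α β)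
    = algebraMap ℝ (PolyP n) ((if ρ = α then 1 else 0) * (if σ = β then 1 else 0)
      - (if ρ = β then 1 else 0) * (if σ = α then 1 else 0)) := by
  rcases lt_trichotomy ρ σ with h | rfl | h <;> rcases lt_trichotomy α β with h' | rfl | h' <;>
    simp [genDeriv, xv, pderiv_X, Pi.single_apply, *, not_lt_of_gt]
  all_goals split_ifs <;> first | (exfalso; lia) | simp

lemma genDeriv_dualVar (a i : GenIdx n) :
    genDeriv a (dualVar i) = algebraMap ℝ (PolyP n) (metricPairing a i) := by
  rcases a with ⟨ρ, σ⟩ | ρ <;> rcases i with ⟨α, β⟩ | α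
  · rw [dualVar, metricPairing, Derivation.map_smul, genDeriv_xv, Algebra.smul_def, ← map_mul]
    rw [etaM_eq_mul_ite ρ α, etaM_eq_mul_ite σ β, etaM_eq_mul_ite ρ β, etaM_eq_mul_ite σ α]
    congr 1
    ring
  · simp only [dualVar, metricPairing, genDeriv, pvar]
    split_ifs <;> simp [pderiv_X]
  · simp only [dualVar, metricPairing, genDeriv, xv]
    split_ifs <;> simp [pderiv_X]
  · simp only [dualVar, metricPairing, genDeriv, pvar, Derivation.map_smul, pderiv_X]
    rcases eq_or_ne ρ α with rfl | h
    · simp [Algebra.smul_def]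
    · simp [etaM_of_ne h, h.symm]

/-- The matrix `K̃` of symbols. -/
noncomputable abbrev symbolMatrix (n : ℕ) : Matrix (GenIdx n) (GenIdx n) (PolyP n) :=
  poincareMatrix dualVar

lemma genDeriv_symbolMatrix (a i j : GenIdx n) :
    genDeriv a (symbolMatrix n i j) = algebraMap ℝ _ (poincareConst i a j) := by
  have h1 := map_poincareOp (τ := dualVar) (v := fun m => pairProj m j)
    (genDeriv a).toLinearMap i
  have h2 := map_poincareOp (τ := metricPairing a) (v := fun m => pairProj m j)
    (Algebra.linearMap ℝ (PolyP n)) i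
  simp only [Derivation.coeFn_coe, genDeriv_dualVar, Algebra.linearMap_apply] at h1 h2
  rw [symbolMatrix, poincareMatrix_eq_poincareOp, h1, ← h2, poincareOp_metricPairing]
  rfl

lemma symbolMatrix_mem_span (i j : GenIdx n) :
    symbolMatrix n i j ∈ Submodule.span ℝ (Set.range (X : PIdx n → PolyP n)) := by
  refine poincareMatrix_mem (fun i => ?_) i j
  have hX (i : PIdx n) : X i ∈ Submodule.span ℝ (Set.range (X : PIdx n → PolyP n)) :=
    Submodule.subset_span ⟨i, rfl⟩
  rcases i with ⟨μ, ν⟩ | μ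
  · refine Submodule.smul_mem _ _ ?_
    rw [xv]
    split_ifs
    · exact hX _
    · exact Submodule.neg_mem _ (hX _)
    · exact Submodule.zero_mem _
  · exact Submodule.smul_mem _ _ (hX _)

lemma pairAntisymm_realization (p : PolyP n) :
    PairAntisymm fun i => realization genVar (symbolMatrix n) i p := by
  intro μ ν
  simp only [realization]
  rw [← finsum_neg_distrib]
  refine finsum_congr fun k => ?_
  rcases k with _ | k
  · rw [realizationPart_zero, realizationPart_zero, pairAntisymm_genVar μ ν, neg_mul, smul_neg]
  · simp only [realizationPart_apply, pow_succ', Matrix.mul_apply,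
      pairAntisymm_poincareMatrix_col _ μ ν, neg_mul,
      Finset.sum_neg_distrib, smul_neg, map_neg, LinearMap.neg_apply, mul_neg]

lemma realization_genVar_commutator (i k : GenIdx n) (p : PolyP n) :
    realization genVar (symbolMatrix n) i (realization genVar (symbolMatrix n) k p)
        - realization genVar (symbolMatrix n) k (realization genVar (symbolMatrix n) i p)
      = poincareBracket (fun j => realization genVar (symbolMatrix n) j p) i k := by
  rw [← sum_poincareConst_smul (pairAntisymm_realization p)]
  exact realization_commutator diffOp_genVar_mul symbolMatrix_mem_span
    (fun a b j => poincareBracket_swap (pairAntisymm_pairProj j) a b)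
    (fun a i j => genDeriv_symbolMatrix a i j) (poincareMatrix_jacobi pairAntisymm_dualVar) i k p

lemma dpair_eq_diffOp (μ ν : Fin n) (p : PolyP n) :
    dpair μ ν p = diffOp (dualVar (Sum.inl (μ, ν))) p := by
  rw [dpair, dualVar, xv]
  split_ifs <;> simp

lemma dsingle_eq_diffOp (μ : Fin n) (p : PolyP n) :
    dsingle μ p = diffOp (dualVar (Sum.inr μ)) p := by
  simp [dsingle, dualVar, pvar]

lemma etaM_smul_Cblock (μ ν α : Fin n) (p : PolyP n) :
    etaM α α • Cblock μ ν α p = diffOp (symbolMatrix n (Sum.inl (μ, ν)) (Sum.inr α)) p := by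
  simp [Cblock, poincareMatrix, dsingle_eq_diffOp]

lemma etaM_smul_Dblock (μ ν α β : Fin n) (p : PolyP n) :
    (etaM α α * etaM β β) • Dblock μ ν α β p
      = diffOp (symbolMatrix n (Sum.inl (μ, ν)) (Sum.inl (α, β))) p := by
  simp [Dblock, poincareMatrix, dpair_eq_diffOp]

lemma symbolMatrix_pow_inr_inl (m : ℕ) (μ : Fin n) (q : Fin n × Fin n) :
    (symbolMatrix n ^ m) (Sum.inr μ) (Sum.inl q) = 0 := by
  induction m generalizing μ with
  | zero => simp
  | succ m ih =>
    simp [pow_succ', Matrix.mul_apply, Fintype.sum_sum_type, ih, poincareMatrix]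

lemma sum_sum_etaM_smul {M : Type*} [AddCommGroup M] [Module ℝ M] (F : Fin n → Fin n → M) :
    ∑ α, ∑ β, etaM α β • F α β = ∑ α, etaM α α • F α α :=
  Finset.sum_congr rfl fun α _ => sum_etaM_smul α (F α)

lemma sum_sum_etaM_mul_smul {M : Type*} [AddCommGroup M] [Module ℝ M]
    (F : Fin n → Fin n → Fin n → Fin n → M) :
    ∑ α, ∑ β, ∑ α', ∑ β', (etaM α α' * etaM β β') • F α β α' β'
      = ∑ α, ∑ β, (etaM α α * etaM β β) • F α β α β := by
  refine Finset.sum_congr rfl fun α _ => Finset.sum_congr rfl fun β _ => ?_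
  simp only [mul_smul, ← Finset.smul_sum]
  rw [sum_etaM_smul]
  simp only [sum_etaM_smul]

lemma Apow_eq_diffOp (m : ℕ) (μ ν : Fin n) (p : PolyP n) :
    Apow m μ ν p = etaM ν ν • diffOp ((symbolMatrix n ^ m) (Sum.inr μ) (Sum.inr ν)) p := by
  induction m generalizing μ ν p with
  | zero =>
    rw [Apow, pow_zero]
    rcases eq_or_ne μ ν with rfl | h
    · simp
    · simp [etaM_of_ne h, h]
  | succ m ih =>
    simp only [Apow, ih, sum_sum_etaM_smul]
    simp [pow_succ, Matrix.mul_apply, symbolMatrix_pow_inr_inl, dpair_eq_diffOp, poincareMatrix,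
      Finset.smul_sum, smul_smul, etaM_mul_self, LinearMap.sum_apply]

lemma Dpow_eq_diffOp (m : ℕ) (μ ν α β : Fin n) (p : PolyP n) :
    Dpow m μ ν α β p = (1 / 2 * (etaM α α * etaM β β)) •
      (diffOp ((symbolMatrix n ^ m) (Sum.inl (μ, ν)) (Sum.inl (α, β))) p
        - diffOp ((symbolMatrix n ^ m) (Sum.inl (μ, ν)) (Sum.inl (β, α))) p) := by
  induction m generalizing μ ν p with
  | zero =>
    have hone (α β : Fin n) :
        diffOp ((1 : Matrix (GenIdx n) (GenIdx n) (PolyP n)) (Sum.inl (μ, ν)) (Sum.inl (α, β))) p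
          = ((if μ = α then 1 else 0) * (if ν = β then 1 else 0) : ℝ) • p := by
      by_cases h : μ = α <;> by_cases h' : ν = β <;> simp [Matrix.one_apply, h, h']
    simp only [Dpow]
    rw [pow_zero, hone, hone, etaM_eq_mul_ite μ α, etaM_eq_mul_ite ν β, etaM_eq_mul_ite μ β,
      etaM_eq_mul_ite ν α]
    module
  | succ m ih =>
    simp only [Dpow, ih, sum_sum_etaM_mul_smul, etaM_smul_Dblock]
    simp only [pow_succ', Matrix.mul_apply, Fintype.sum_sum_type, Fintype.sum_prod_type,
      symbolMatrix_pow_inr_inl, mul_zero, Finset.sum_const_zero, add_zero, map_sum, map_smul,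
      map_sub, LinearMap.sum_apply, map_mul, Module.End.mul_apply, ← Finset.smul_sum,
      Finset.sum_sub_distrib]

lemma LLpow_eq_diffOp (m : ℕ) (μ ν α : Fin n) (p : PolyP n) :
    LLpow m μ ν α p
      = etaM α α • diffOp ((symbolMatrix n ^ m) (Sum.inl (μ, ν)) (Sum.inr α)) p := by
  induction m generalizing μ ν p with
  | zero => simp [LLpow]
  | succ m ih =>
    simp only [LLpow, ih, Apow_eq_diffOp, sum_sum_etaM_mul_smul, sum_sum_etaM_smul,
      etaM_smul_Dblock, etaM_smul_Cblock]
    simp only [pow_succ', Matrix.mul_apply, Fintype.sum_sum_type, Fintype.sum_prod_type,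
      map_sum, map_add, map_smul, LinearMap.sum_apply, LinearMap.add_apply, map_mul,
      Module.End.mul_apply, ← Finset.smul_sum, smul_add]
    rw [add_comm]

/-- The entries of `ψ(K̃)`. -/
noncomputable def psiOp (i j : GenIdx n) (p : PolyP n) : PolyP n :=
  ∑ᶠ k, bcoef k • diffOp ((symbolMatrix n ^ k) i j) p

lemma exists_psiOp_eq_sum_range (p : PolyP n) : ∃ N,
    (∀ k ≥ N, ∀ i j, diffOp ((symbolMatrix n ^ k) i j) p = 0) ∧
    ∀ i j, psiOp i j p = ∑ k ∈ Finset.range N, bcoef k • diffOp ((symbolMatrix n ^ k) i j) p := by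
  obtain ⟨N, hN⟩ := exists_forall_diffOp_pow_eq_zero symbolMatrix_mem_span p
  exact ⟨N, hN, fun i j => finsum_eq_sum_range fun k hk => by rw [hN k hk, smul_zero]⟩

lemma realization_eq_sum_psiOp (i : GenIdx n) (p : PolyP n) :
    realization genVar (symbolMatrix n) i p = ∑ j, genVar j * psiOp i j p := by
  obtain ⟨N, hN, hpsi⟩ := exists_psiOp_eq_sum_range p
  rw [realization, finsum_eq_sum_range (N := N)]
  · simp only [hpsi, realizationPart_apply, Finset.mul_sum, map_smul, LinearMap.smul_apply]
    exact Finset.sum_comm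
  · intro k hk
    simp [realizationPart_apply, hN k hk]

lemma psiA_eq_psiOp (μ ν : Fin n) (p : PolyP n) :
    psiA μ ν p = etaM ν ν • psiOp (Sum.inr μ) (Sum.inr ν) p := by
  simp only [psiA, psiOp, Apow_eq_diffOp, smul_finsum, smul_comm (bcoef _)]

lemma psiLL_eq_psiOp (μ ν α : Fin n) (p : PolyP n) :
    psiLL μ ν α p = etaM α α • psiOp (Sum.inl (μ, ν)) (Sum.inr α) p := by
  simp only [psiLL, psiOp, LLpow_eq_diffOp, smul_finsum, smul_comm (bcoef _)]

lemma psiD_eq_psiOp (μ ν α β : Fin n) (p : PolyP n) :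
    psiD μ ν α β p = (1 / 2 * (etaM α α * etaM β β)) •
      (psiOp (Sum.inl (μ, ν)) (Sum.inl (α, β)) p - psiOp (Sum.inl (μ, ν)) (Sum.inl (β, α)) p) := by
  obtain ⟨N, hN, hpsi⟩ := exists_psiOp_eq_sum_range p
  simp only [psiD, Dpow_eq_diffOp]
  rw [finsum_eq_sum_range (N := N) fun k hk => by simp [hN k hk], hpsi, hpsi,
    ← Finset.sum_sub_distrib, Finset.smul_sum]
  exact Finset.sum_congr rfl fun k _ => by module

lemma psiOp_inr_inl (μ : Fin n) (q : Fin n × Fin n) (p : PolyP n) :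
    psiOp (Sum.inr μ) (Sum.inl q) p = 0 := by
  simp [psiOp, symbolMatrix_pow_inr_inl]

lemma Phat_eq_realization (μ : Fin n) :
    Phat μ = realization genVar (symbolMatrix n) (Sum.inr μ) := by
  funext p
  simp only [Phat, sum_sum_etaM_smul]
  simp only [realization_eq_sum_psiOp, psiA_eq_psiOp, mul_smul_comm, smul_smul, etaM_mul_self,
    one_smul, Fintype.sum_sum_type, psiOp_inr_inl, mul_zero, Finset.sum_const_zero, zero_add,
    genVar]

lemma Mhat_eq_realization (μ ν : Fin n) :
    Mhat μ ν = realization genVar (symbolMatrix n) (Sum.inl (μ, ν)) := by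
  funext p
  have h (α β : Fin n) (q : PolyP n) : (etaM α α * etaM β β) •
      (1 / 2 * (etaM α α * etaM β β)) • q = (1 / 2 : ℝ) • q := by
    rw [smul_smul, mul_left_comm, mul_mul_mul_comm, etaM_mul_self, etaM_mul_self, one_mul, mul_one]
  have hswap : ∑ α, ∑ β, xv α β * psiOp (Sum.inl (μ, ν)) (Sum.inl (β, α)) p
      = - ∑ α, ∑ β, xv α β * psiOp (Sum.inl (μ, ν)) (Sum.inl (α, β)) p := by
    rw [Finset.sum_comm, ← Finset.sum_neg_distrib]
    refine Finset.sum_congr rfl fun α _ => ?_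
    rw [← Finset.sum_neg_distrib]
    exact Finset.sum_congr rfl fun β _ => by rw [xv_swap, neg_mul]
  have h' (α : Fin n) (q : PolyP n) : etaM α α • etaM α α • q = q := by
    rw [smul_smul, etaM_mul_self, one_smul]
  simp only [Mhat, sum_sum_etaM_smul, sum_sum_etaM_mul_smul, realization_eq_sum_psiOp,
    psiD_eq_psiOp, psiLL_eq_psiOp, mul_smul_comm, h, h', Fintype.sum_sum_type,
    Fintype.sum_prod_type, genVar, mul_sub, ← Finset.smul_sum, Finset.sum_sub_distrib, hswap]
  module

end Poincare

/-- Eqs. (4.9)–(4.10): the operators `P̂_μ, M̂_{μν}` satisfy the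
Poincaré algebra relations. -/
theorem statement18 (n : ℕ) (hn : 2 ≤ n) :
    (∀ μ ν : Fin n, Phat μ ∘ Phat ν - Phat ν ∘ Phat μ = 0) ∧
    (∀ μ ν lam : Fin n,
      Mhat μ ν ∘ Phat lam - Phat lam ∘ Mhat μ ν
        = etaM ν lam • Phat μ - etaM μ lam • Phat ν) ∧
    (∀ μ ν ρ σ : Fin n,
      Mhat μ ν ∘ Mhat ρ σ - Mhat ρ σ ∘ Mhat μ ν
        = etaM ν ρ • Mhat μ σ - etaM μ ρ • Mhat ν σ
          - etaM ν σ • Mhat μ ρ + etaM μ σ • Mhat ν ρ) := by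
  refine ⟨fun μ ν => ?_, fun μ ν lam => ?_, fun μ ν ρ σ => ?_⟩ <;> funext p <;>
    simp only [Phat_eq_realization, Mhat_eq_realization] <;>
    exact realization_genVar_commutator _ _ p
end
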